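/- arXiv:1902.09284 — 12 statements merged into one kernel-verified Lean document; each statement's English description precedes it below -/
import Mathlib

section
/- Let (x_n) be a sequence of nonnegative real numbers with x_0 < K. Then for every ε > 0 and every function f : ℕ → ℕ there exists N ≤ (f*)^(⌈K/ε⌉)(0) such that x_N − ε ≤ x_i for all i ≤ f(N). -/
/-- `fStar f n = max_{i ≤ n} max (n, f i)`. -/
def fStar (f : ℕ → ℕ) (n : ℕ) : ℕ := (Finset.range (n + 1)).sup fun i => max n (f i)

theorem max_le_fStar (f : ℕ → ℕ) {i n : ℕ} (h : i ≤ n) : max n (f i) ≤ fStar f n :=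
  Finset.le_sup (f := fun i => max n (f i)) (Finset.mem_range.2 (Nat.lt_succ_of_le h))

/-- Within `m` iterations of `fStar f`, either the sequence is `ε`-almost minimal at some index
on the window given by `f`, or it has decreased by at least `m * ε`. -/
theorem exists_almost_min_or_decrease (x : ℕ → ℝ) (ε : ℝ) (f : ℕ → ℕ) (m : ℕ) :
    (∃ N ≤ (fStar f)^[m] 0, ∀ i ≤ f N, x N - ε ≤ x i) ∨
      ∃ n ≤ (fStar f)^[m] 0, x n ≤ x 0 - m * ε := by
  induction m with
  | zero => exact Or.inr ⟨0, le_rfl, by simp⟩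
  | succ m ih =>
    rw [Function.iterate_succ_apply']
    rcases ih with ⟨N, hN, h⟩ | ⟨n, hn, h⟩
    · exact Or.inl ⟨N, hN.trans ((le_max_left _ _).trans (max_le_fStar f hN)), h⟩
    · have hmax := max_le_fStar f hn
      by_cases hgood : ∀ i ≤ f n, x n - ε ≤ x i
      · exact Or.inl ⟨n, hn.trans ((le_max_left _ _).trans hmax), hgood⟩
      · push Not at hgood
        obtain ⟨i, hi, hlt⟩ := hgood
        refine Or.inr ⟨i, hi.trans ((le_max_right _ _).trans hmax), ?_⟩
        push_cast
        linarith

/-- Let `(x n)` be a sequence of nonnegative reals with `x 0 < K`.  Then for every `ε > 0`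
and every `f : ℕ → ℕ` there exists `N ≤ (f*)^(⌈K/ε⌉)(0)` such that `x N - ε ≤ x i` for all
`i ≤ f N`. -/
theorem stmt2 (x : ℕ → ℝ) (hx : ∀ n, 0 ≤ x n) (K : ℝ) (hK : 0 < K) (hxK : x 0 < K)
    (ε : ℝ) (hε : 0 < ε) (f : ℕ → ℕ) :
    ∃ N ≤ (fStar f)^[⌈K / ε⌉₊] 0, ∀ i ≤ f N, x N - ε ≤ x i := by
  refine (exists_almost_min_or_decrease x ε f ⌈K / ε⌉₊).resolve_right ?_
  rintro ⟨n, -, hn⟩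
  have hceil : K ≤ ⌈K / ε⌉₊ * ε := (div_le_iff₀ hε).1 (Nat.le_ceil _)
  linarith [hx n]
end

section
/- Let (x_n) be a sequence of nonnegative real numbers with x_0 < K, and suppose Γ is a metastable rate of asymptotic decreasingness for (x_n), i.e. for all ε > 0, g : ℕ → ℕ and N ∈ ℕ there exists n ≤ Γ(ε, g, N) such that x_i ≤ x_N + ε for all i ∈ [n, n + g(n)]. Then the function Φ(ε, g) := Γ*(ε/2, g, f^(⌈2K/ε⌉)(0)), where f(j) := Γ*(ε/2, g, j) + g*(Γ*(ε/2, g, j)), is a rate of metastability for (x_n): for all ε > 0 and g : ℕ → ℕ there exists n ≤ Φ(ε, g) such that |x_i − x_j| ≤ ε for all i, j ∈ [n, n + g(n)]. -/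
/-- `ΓStar Γ ε g N = max_{i ≤ N} max (N, Γ ε g i)`. -/
def ΓStar (Γ : ℝ → (ℕ → ℕ) → ℕ → ℕ) (ε : ℝ) (g : ℕ → ℕ) (N : ℕ) : ℕ :=
  (Finset.range (N + 1)).sup fun i => max N (Γ ε g i)

theorem le_fStar {f : ℕ → ℕ} {i n : ℕ} (h : i ≤ n) : f i ≤ fStar f n :=
  (le_max_right n (f i)).trans <|
    Finset.le_sup (f := fun i => max n (f i)) (Finset.mem_range.2 (by omega))

theorem le_ΓStar_of_le (Γ : ℝ → (ℕ → ℕ) → ℕ → ℕ) (ε : ℝ) (g : ℕ → ℕ) {i N : ℕ} (h : i ≤ N) :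
    Γ ε g i ≤ ΓStar Γ ε g N :=
  (le_max_right N (Γ ε g i)).trans <|
    Finset.le_sup (f := fun i => max N (Γ ε g i)) (Finset.mem_range.2 (by omega))

theorem self_le_ΓStar (Γ : ℝ → (ℕ → ℕ) → ℕ → ℕ) (ε : ℝ) (g : ℕ → ℕ) (N : ℕ) :
    N ≤ ΓStar Γ ε g N :=
  (le_max_left N (Γ ε g N)).trans <|
    Finset.le_sup (f := fun i => max N (Γ ε g i)) (Finset.mem_range.2 (by omega))

/-- If `(x n)` is a sequence of nonnegative reals with `x 0 < K` and `Γ` is a metastable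
rate of asymptotic decreasingness for `(x n)`, then
`Φ(ε, g) := Γ*(ε/2, g, f^(⌈2K/ε⌉)(0))`, with `f j := Γ*(ε/2, g, j) + g*(Γ*(ε/2, g, j))`,
is a rate of metastability for `(x n)`. -/
theorem stmt3 (x : ℕ → ℝ) (hx : ∀ n, 0 ≤ x n) (K : ℝ) (hK : 0 < K) (hxK : x 0 < K)
    (Γ : ℝ → (ℕ → ℕ) → ℕ → ℕ)
    (hΓ : ∀ ε > (0 : ℝ), ∀ g : ℕ → ℕ, ∀ N : ℕ, ∃ n ≤ Γ ε g N,
      ∀ i ∈ Set.Icc n (n + g n), x i ≤ x N + ε) :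
    ∀ ε > (0 : ℝ), ∀ g : ℕ → ℕ,
      ∃ n ≤ ΓStar Γ (ε / 2) g
          ((fun j => ΓStar Γ (ε / 2) g j + fStar g (ΓStar Γ (ε / 2) g j))^[⌈2 * K / ε⌉₊] 0),
        ∀ i ∈ Set.Icc n (n + g n), ∀ j ∈ Set.Icc n (n + g n), |x i - x j| ≤ ε := by
  intro ε hε g
  set f : ℕ → ℕ := fun j => ΓStar Γ (ε / 2) g j + fStar g (ΓStar Γ (ε / 2) g j)
  set M := ⌈2 * K / ε⌉₊
  have hε2 : ε / 2 > 0 := half_pos hε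
  have hself : id ≤ f := fun j => (self_le_ΓStar Γ (ε / 2) g j).trans (Nat.le_add_right _ _)
  by_contra! hcon
  have key : ∀ k ≤ M, ∃ N ≤ f^[k] 0, x N < K - k * (ε / 2) := by
    intro k
    induction k with
    | zero => exact fun _ => ⟨0, le_rfl, by simpa using hxK⟩
    | succ k ih =>
      intro hk
      obtain ⟨N, hN, hxN⟩ := ih (by omega)
      obtain ⟨n, hn, hup⟩ := hΓ (ε / 2) hε2 g N
      have hNM : N ≤ f^[M] 0 :=
        hN.trans (Function.monotone_iterate_of_id_le hself (by omega : k ≤ M) 0)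
      obtain ⟨i, hi, j, hj, hij⟩ := hcon n (hn.trans (le_ΓStar_of_le Γ (ε / 2) g hNM))
      have hlow : ∃ m ∈ Set.Icc n (n + g n), x m < x N - ε / 2 := by
        by_contra! h
        refine hij.not_ge (abs_le.2 ⟨?_, ?_⟩)
        · linarith [h i hi, hup j hj]
        · linarith [h j hj, hup i hi]
      obtain ⟨m, hm, hxm⟩ := hlow
      have hnS := hn.trans (le_ΓStar_of_le Γ (ε / 2) g hN)
      refine ⟨m, ?_, ?_⟩
      · rw [Function.iterate_succ_apply']
        exact hm.2.trans (add_le_add hnS (le_fStar hnS))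
      · push_cast
        linarith
  obtain ⟨N, -, hxN⟩ := key M le_rfl
  have hceil : 2 * K / ε ≤ M := Nat.le_ceil _
  rw [div_le_iff₀ hε] at hceil
  linarith [hx N]
end

section
/- Let C be a subset of a uniformly convex Banach space X and T : C → C a mapping whose fixed point set Fix(T) contains a closed ball B_r[p] of X (p ∈ Fix(T), r > 0). Let x ∈ C and suppose that for every q ∈ Fix(T), every ε > 0 and every N ∈ ℕ there exists n such that ‖T^i x − q‖ ≤ ‖T^N x − q‖ + ε for all i ≥ n. Then the sequence of Picard iterates (T^n x)_{n∈ℕ} is a Cauchy sequence. -/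
theorem UniformConvexSpace.exists_forall_norm_sub_lt_of_norm_add_ge (E : Type*)
    [NormedAddCommGroup E] [NormedSpace ℝ E] [UniformConvexSpace E] {R ε : ℝ}
    (hR : 0 < R) (hε : 0 < ε) :
    ∃ δ, 0 < δ ∧ ∀ ⦃a c : E⦄, ‖a‖ ≤ R + δ → ‖c‖ ≤ R → 2 * R - δ ≤ ‖a + c‖ → ‖a - c‖ < ε := by
  obtain ⟨δ₀, hδ₀, h⟩ := exists_forall_closed_ball_dist_add_le_two_sub E
    (show 0 < ε / (2 * R) by positivity)
  refine ⟨min R (δ₀ * R / 4), by positivity, fun a c ha hc hac => ?_⟩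
  set δ := min R (δ₀ * R / 4) with hδ
  have hδR : δ ≤ R := min_le_left _ _
  have hδδ₀ : δ ≤ δ₀ * R / 4 := min_le_right _ _
  have hδ_pos : 0 < δ := by positivity
  have hS : 0 < R + δ := by positivity
  by_contra! hε_le
  have norm_inv_smul (z : E) : ‖(R + δ)⁻¹ • z‖ = ‖z‖ / (R + δ) := by
    rw [norm_smul_of_nonneg (by positivity), inv_mul_eq_div]
  have key := @h ((R + δ)⁻¹ • a) (by rw [norm_inv_smul, div_le_one hS]; exact ha)
    ((R + δ)⁻¹ • c) (by rw [norm_inv_smul, div_le_one hS]; linarith)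
    (by
      rw [← smul_sub, norm_inv_smul]
      exact div_le_div₀ (norm_nonneg _) hε_le hS (by linarith))
  rw [← smul_add, norm_inv_smul, div_le_iff₀ hS] at key
  nlinarith [mul_pos hδ₀ hδ_pos, mul_pos hδ₀ hR]

theorem cauchySeq_of_forall_exists_norm_sub_lt {E : Type*} [SeminormedAddCommGroup E] {u : ℕ → E}
    (h : ∀ ε > (0 : ℝ), ∃ z, ∃ n, ∀ i ≥ n, ‖u i - z‖ < ε) : CauchySeq u := by
  refine Metric.cauchySeq_iff.2 fun ε hε => ?_
  obtain ⟨z, n, hn⟩ := h (ε / 2) (half_pos hε)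
  refine ⟨n, fun i hi j hj => ?_⟩
  have hi' := hn i hi
  have hj' := hn j hj
  rw [← dist_eq_norm] at hi' hj'
  linarith [dist_triangle_right (u i) (u j) z]

/-- In a uniformly convex space, a sequence whose distances to every point of a ball are
asymptotically nonincreasing is Cauchy. -/
theorem UniformConvexSpace.cauchySeq_of_norm_sub_le_on_closedBall {E : Type*}
    [NormedAddCommGroup E] [NormedSpace ℝ E] [UniformConvexSpace E] {u : ℕ → E} {p : E} {r : ℝ}
    (hr : 0 < r)
    (hdec : ∀ q ∈ Metric.closedBall p r, ∀ ε > (0 : ℝ), ∀ N : ℕ,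
      ∃ n : ℕ, ∀ i ≥ n, ‖u i - q‖ ≤ ‖u N - q‖ + ε) :
    CauchySeq u := by
  refine cauchySeq_of_forall_exists_norm_sub_lt fun ε hε => ?_
  set d := ⨅ n, ‖u n - p‖ with hd
  have hd_le (n : ℕ) : d ≤ ‖u n - p‖ := ciInf_le ⟨0, by rintro _ ⟨n, rfl⟩; exact norm_nonneg _⟩ n
  have exists_lt {η : ℝ} (hη : 0 < η) : ∃ N, ‖u N - p‖ < d + η :=
    exists_lt_of_ciInf_lt (lt_add_of_pos_right d hη)
  obtain hd0 | hd0 := (Real.iInf_nonneg fun n => norm_nonneg (u n - p)).eq_or_lt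
  · obtain ⟨N, hN⟩ := exists_lt (half_pos hε)
    obtain ⟨n, hn⟩ := hdec p (Metric.mem_closedBall_self hr.le) (ε / 2) (half_pos hε) N
    exact ⟨p, n, fun i hi => by linarith [hn i hi]⟩
  · rw [← hd] at hd0
    obtain ⟨s, hs, hsr, hsd⟩ : ∃ s, 0 < s ∧ s ≤ r ∧ s ≤ d / 2 :=
      ⟨min r (d / 2), by positivity, min_le_left _ _, min_le_right _ _⟩
    obtain ⟨δ, hδ, h⟩ := exists_forall_norm_sub_lt_of_norm_add_ge E
      (show 0 < d - s by linarith) hε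
    obtain ⟨t, hts⟩ : ∃ t, t * s = d - s := ⟨(d - s) / s, div_mul_cancel₀ _ hs.ne'⟩
    have ht : 1 ≤ t := by
      by_contra! ht
      nlinarith
    obtain ⟨η, hη, htη⟩ : ∃ η, 0 < η ∧ t * (2 * η) = δ :=
      ⟨δ / (2 * t), by positivity, by field_simp⟩
    have hηδ : 2 * η ≤ δ := by nlinarith
    obtain ⟨N, hN⟩ := exists_lt hη
    have hv : 0 < ‖u N - p‖ := hd0.trans_le (hd_le N)
    set v := u N - p with hv_def
    set b := (s / ‖v‖) • v with hb_def
    have hb : ‖b‖ = s := by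
      rw [hb_def, norm_smul_of_nonneg (by positivity), div_mul_cancel₀ _ hv.ne']
    have huN : ‖u N - (p + b)‖ = ‖v‖ - s := by
      have hsv : s / ‖v‖ ≤ 1 := (div_le_one hv).2 (by linarith [hd_le N])
      rw [show u N - (p + b) = (1 - s / ‖v‖) • v by rw [sub_smul, one_smul, hv_def]; abel,
        norm_smul_of_nonneg (by linarith), sub_mul, one_mul, div_mul_cancel₀ _ hv.ne']
    obtain ⟨n, hn⟩ := hdec (p + b) (by simpa [hb] using hsr) η hη N
    refine ⟨p + b + t • b, n, fun i hi => ?_⟩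
    have ha : ‖u i - (p + b)‖ ≤ d - s + 2 * η := by linarith [hn i hi]
    have hsum : t * d - (t - 1) * (d - s + 2 * η) ≤ ‖u i - (p + b) + t • b‖ := calc
      _ ≤ t * ‖u i - p‖ - (t - 1) * ‖u i - (p + b)‖ := by
        gcongr
        exact hd_le i
      _ = ‖t • (u i - p)‖ - ‖(t - 1) • (u i - (p + b))‖ := by
        rw [norm_smul_of_nonneg (by linarith), norm_smul_of_nonneg (by linarith)]
      _ ≤ ‖t • (u i - p) - (t - 1) • (u i - (p + b))‖ := norm_sub_norm_le _ _
      _ = _ := by congr 1; module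
    rw [← sub_sub]
    refine h (by linarith) ?_ ?_
    · rw [norm_smul_of_nonneg (by linarith), hb, hts]
    · linarith

/-- Let `C` be a subset of a uniformly convex Banach space `X` and `T : C → C` a mapping whose
fixed point set contains a closed ball `B_r[p]` (`p ∈ Fix T`, `r > 0`).  Let `x ∈ C` and suppose
that for every fixed point `q`, every `ε > 0` and every `N` there exists `n` such that
`‖T^i x - q‖ ≤ ‖T^N x - q‖ + ε` for all `i ≥ n`.  Then the sequence of Picard iterates
`(T^n x)` is Cauchy. -/
theorem stmt4 {X : Type*} [NormedAddCommGroup X] [NormedSpace ℝ X]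
    [UniformConvexSpace X] [CompleteSpace X]
    (C : Set X) (T : X → X) (hT : Set.MapsTo T C C)
    (p : X) (r : ℝ) (hr : 0 < r)
    (hball : Metric.closedBall p r ⊆ {y | y ∈ C ∧ T y = y})
    (x : X) (hx : x ∈ C)
    (hdec : ∀ q ∈ {y | y ∈ C ∧ T y = y}, ∀ ε > (0 : ℝ), ∀ N : ℕ,
      ∃ n : ℕ, ∀ i ≥ n, ‖T^[i] x - q‖ ≤ ‖T^[N] x - q‖ + ε) :
    CauchySeq fun n : ℕ => T^[n] x := by
  exact UniformConvexSpace.cauchySeq_of_norm_sub_le_on_closedBall hr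
    fun q hq => hdec q (hball hq)
end

section
/- Let C be a nonempty closed subset of a uniformly convex Banach space X and T : C → C an asymptotically nonexpansive mapping whose fixed point set Fix(T) contains a closed ball B_r[p] of X (p ∈ Fix(T), r > 0). Then for each x ∈ C the sequence of Picard iterates (T^n x)_{n∈ℕ} converges to a fixed point of T. -/
open Filter Topology

/-- In a uniformly convex space, midpoints of `ε`-separated points whose norms exceed `d` only
slightly have norm bounded away from `d`. -/
lemma exists_forall_norm_add_le_of_norm_le_add {X : Type*} [NormedAddCommGroup X]
    [NormedSpace ℝ X] [UniformConvexSpace X] {ε d : ℝ} (hε : 0 < ε) (hd : 0 < d) :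
    ∃ δ > 0, ∀ a b : X, ‖a‖ ≤ d + δ → ‖b‖ ≤ d + δ → ε ≤ ‖a - b‖ → ‖a + b‖ ≤ 2 * d - δ := by
  obtain ⟨δ₀, hδ₀, h⟩ := exists_forall_closed_ball_dist_add_le_two_mul_sub X (half_pos hε) d
  obtain ⟨δ, hδ, hδε, hδδ⟩ : ∃ δ > 0, δ ≤ ε / 4 ∧ δ ≤ δ₀ / 3 :=
    ⟨min (ε / 4) (δ₀ / 3), by positivity, min_le_left _ _, min_le_right _ _⟩
  have scale : ∀ a : X, ‖a‖ ≤ d + δ → ∃ a' : X, ‖a'‖ ≤ d ∧ ‖a - a'‖ ≤ δ := by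
    intro a ha
    have hpos : 0 < d + δ := by positivity
    refine ⟨(d / (d + δ)) • a, ?_, ?_⟩
    · rw [norm_smul, Real.norm_of_nonneg (by positivity), div_mul_eq_mul_div, div_le_iff₀ hpos]
      gcongr
    · have : a - (d / (d + δ)) • a = (δ / (d + δ)) • a := by
        rw [sub_eq_iff_eq_add, ← add_smul, ← add_div, add_comm δ, div_self hpos.ne', one_smul]
      rw [this, norm_smul, Real.norm_of_nonneg (by positivity), div_mul_eq_mul_div,
        div_le_iff₀ hpos]
      gcongr
  refine ⟨δ, hδ, fun a b ha hb hab => ?_⟩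
  obtain ⟨a', ha', haa⟩ := scale a ha
  obtain ⟨b', hb', hbb⟩ := scale b hb
  have hsep : ‖a - b‖ ≤ ‖a' - b'‖ + (‖a - a'‖ + ‖b - b'‖) := by
    have : a - b = (a' - b') + ((a - a') - (b - b')) := by abel
    rw [this]
    exact (norm_add_le _ _).trans (add_le_add le_rfl (norm_sub_le _ _))
  have hsum : ‖a + b‖ ≤ ‖a' + b'‖ + (‖a - a'‖ + ‖b - b'‖) := by
    have : a + b = (a' + b') + ((a - a') + (b - b')) := by abel
    rw [this]
    exact (norm_add_le _ _).trans (add_le_add le_rfl (norm_add_le _ _))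
  have := h ha' hb' (by linarith)
  linarith

/-- A sequence in a uniformly convex space that is asymptotically Fejér monotone with respect to
a closed ball centred at the origin is Cauchy. -/
lemma cauchySeq_of_norm_sub_le_mul_of_mem_closedBall {X : Type*} [NormedAddCommGroup X]
    [NormedSpace ℝ X] [UniformConvexSpace X] {μ : ℕ → ℝ} (hμ : Tendsto μ atTop (𝓝 1))
    {v : ℕ → X} {r : ℝ} (hr : 0 < r)
    (hv : ∀ q : X, ‖q‖ ≤ r → ∀ n k, ‖v (n + k) - q‖ ≤ μ k * ‖v n - q‖) : CauchySeq v := by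
  have hv0 : ∀ n k, ‖v (n + k)‖ ≤ μ k * ‖v n‖ := by simpa using hv 0 (by simpa using hr.le)
  have hbdd : BddBelow (Set.range fun n => ‖v n‖) :=
    ⟨0, by rintro _ ⟨n, rfl⟩; exact norm_nonneg _⟩
  obtain ⟨d, hd⟩ : ∃ d, d = ⨅ n, ‖v n‖ := ⟨_, rfl⟩
  have hdle : ∀ n, d ≤ ‖v n‖ := fun n => hd ▸ ciInf_le hbdd n
  have hd0 : 0 ≤ d := hd ▸ Real.iInf_nonneg fun _ => norm_nonneg _
  have hlt : ∀ η > 0, ∃ N, ∀ n ≥ N, ‖v n‖ < d + η := by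
    intro η hη
    obtain ⟨n₀, hn₀⟩ := exists_lt_of_ciInf_lt (show ⨅ n, ‖v n‖ < d + η by linarith)
    have ht : Tendsto (fun k => μ k * ‖v n₀‖) atTop (𝓝 ‖v n₀‖) := by
      simpa using hμ.mul_const ‖v n₀‖
    obtain ⟨K, hK⟩ := eventually_atTop.1 (ht.eventually_lt_const hn₀)
    refine ⟨n₀ + K, fun n hn => ?_⟩
    obtain ⟨k, rfl⟩ := Nat.exists_eq_add_of_le (show n₀ ≤ n by omega)
    exact (hv0 n₀ k).trans_lt (hK k (by omega))
  rcases hd0.eq_or_lt with hd0 | hd0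
  · have : Tendsto v atTop (𝓝 0) := by
      refine Metric.tendsto_atTop.2 fun η hη => ?_
      simpa [← hd0] using hlt η hη
    exact this.cauchySeq
  suffices key : ∀ ε > 0, ∃ N K, ∀ n ≥ N, ∀ k ≥ K, ‖v n - v (n + k)‖ < ε by
    refine Metric.cauchySeq_iff.2 fun ε hε => ?_
    obtain ⟨N, K, h⟩ := key (ε / 2) (half_pos hε)
    refine ⟨N, fun m hm n hn => ?_⟩
    have h₁ := h m hm (n + K) (by omega)
    have h₂ := h n hn (m + K) (by omega)
    rw [← dist_eq_norm] at h₁ h₂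
    rw [show n + (m + K) = m + (n + K) by omega] at h₂
    linarith [dist_triangle_right (v m) (v n) (v (m + (n + K)))]
  intro ε hε
  obtain ⟨δ, hδ, huc⟩ := exists_forall_norm_add_le_of_norm_le_add (X := X) hε hd0
  obtain ⟨l, hl, hl2, hlr⟩ : ∃ l > 0, l ≤ 1 / 2 ∧ l * (2 * (d + 1)) ≤ r :=
    ⟨min (1 / 2) (r / (2 * (d + 1))), by positivity, min_le_left _ _,
      (le_div_iff₀ (by positivity)).1 (min_le_right _ _)⟩
  obtain ⟨η, hη, hη1, hηδ, hηl⟩ : ∃ η > 0, η ≤ 1 ∧ η ≤ δ ∧ η * (d + 5) ≤ l * δ :=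
    ⟨min (min 1 δ) (l * δ / (d + 5)), by positivity, (min_le_left _ _).trans (min_le_left _ _),
      (min_le_left _ _).trans (min_le_right _ _),
      (le_div_iff₀ (by positivity)).1 (min_le_right _ _)⟩
  obtain ⟨N, hN⟩ := hlt η hη
  obtain ⟨K, hK⟩ := eventually_atTop.1
    (hμ.eventually_lt_const (show (1 : ℝ) < 1 + η by linarith))
  refine ⟨N, K, fun n hn k hk => ?_⟩
  by_contra! hfar
  have ha := hN n hn
  have hb := hN (n + k) (by omega)
  have hbd := hdle (n + k)
  have hμk := hK k hk
  have hq := hv (l • (v n - v (n + k)))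
  replace hq := fun h => hq h n k
  generalize v n = a at *
  generalize v (n + k) = b at *
  have hmid := huc a b (by linarith) (by linarith) hfar
  replace hq := hq <| by
    rw [norm_smul, Real.norm_of_nonneg hl.le]
    have := norm_sub_le a b
    exact (mul_le_mul_of_nonneg_left (by linarith) hl.le).trans hlr
  have haq : ‖a - l • (a - b)‖ ≤ (1 - 2 * l) * ‖a‖ + l * ‖a + b‖ := by
    have : a - l • (a - b) = (1 - 2 * l) • a + l • (a + b) := by module
    rw [this]
    refine (norm_add_le _ _).trans_eq ?_
    rw [norm_smul, norm_smul, Real.norm_of_nonneg (by linarith), Real.norm_of_nonneg hl.le]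
  have hbq : (1 + l) * ‖b‖ ≤ ‖b - l • (a - b)‖ + l * ‖a‖ := by
    have : (1 + l) • b = (b - l • (a - b)) + l • a := by module
    rw [← Real.norm_of_nonneg (show 0 ≤ 1 + l by linarith), ← norm_smul, this]
    refine (norm_add_le _ _).trans_eq ?_
    rw [norm_smul, Real.norm_of_nonneg hl.le]
  have haq' : ‖a - l • (a - b)‖ ≤ d + η - l * δ := by
    have h₁ : (1 - 2 * l) * ‖a‖ ≤ (1 - 2 * l) * (d + η) :=
      mul_le_mul_of_nonneg_left ha.le (by linarith)
    have h₂ : l * ‖a + b‖ ≤ l * (2 * d - δ) := mul_le_mul_of_nonneg_left hmid hl.le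
    have h₃ : 0 < l * η := by positivity
    linarith
  have hlδ : 0 < l * δ := by positivity
  have h₁ : μ k * ‖a - l • (a - b)‖ ≤ (1 + η) * ‖a - l • (a - b)‖ :=
    mul_le_mul_of_nonneg_right hμk.le (norm_nonneg _)
  have h₂ : η * ‖a - l • (a - b)‖ ≤ η * (d + 1) :=
    mul_le_mul_of_nonneg_left (by linarith) hη.le
  have h₃ : (1 + l) * d ≤ (1 + l) * ‖b‖ := mul_le_mul_of_nonneg_left hbd (by linarith)
  have h₄ : l * ‖a‖ ≤ l * (d + η) := mul_le_mul_of_nonneg_left ha.le hl.le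
  have h₅ : l * η ≤ 1 / 2 * η := mul_le_mul_of_nonneg_right hl2 hη.le
  linarith


/-- Let `C` be a nonempty closed subset of a uniformly convex Banach space `X` and `T : C → C`
an asymptotically nonexpansive mapping whose fixed point set contains a closed ball `B_r[p]`
(`p ∈ Fix T`, `r > 0`).  Then for each `x ∈ C` the Picard iterates `(T^n x)` converge to a
fixed point of `T`. -/
theorem stmt6 {X : Type*} [NormedAddCommGroup X] [NormedSpace ℝ X]
    [UniformConvexSpace X] [CompleteSpace X]
    (C : Set X) (hCne : C.Nonempty) (hCcl : IsClosed C)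
    (T : X → X) (hT : Set.MapsTo T C C)
    (μ : ℕ → ℝ) (hμ : Filter.Tendsto μ Filter.atTop (nhds 1))
    (hane : ∀ x ∈ C, ∀ y ∈ C, ∀ n : ℕ, ‖T^[n] x - T^[n] y‖ ≤ μ n * ‖x - y‖)
    (p : X) (r : ℝ) (hr : 0 < r)
    (hball : Metric.closedBall p r ⊆ {y | y ∈ C ∧ T y = y})
    (x : X) (hx : x ∈ C) :
    ∃ y : X, y ∈ C ∧ T y = y ∧
      Filter.Tendsto (fun n : ℕ => T^[n] x) Filter.atTop (nhds y) := by
  have hfix : ∀ q ∈ Metric.closedBall p r, ∀ n, T^[n] q = q := fun q hq n =>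
    Function.iterate_fixed (hball hq).2 n
  have hmem : ∀ n, T^[n] x ∈ C := fun n => hT.iterate n hx
  have hcau : CauchySeq fun n => T^[n] x - p := by
    refine cauchySeq_of_norm_sub_le_mul_of_mem_closedBall hμ hr fun q hq n k => ?_
    have hpq : p + q ∈ Metric.closedBall p r := by simpa using hq
    have := hane _ (hmem n) _ (hball hpq).1 k
    rwa [hfix _ hpq, ← Function.iterate_add_apply, add_comm k, ← sub_sub, ← sub_sub] at this
  obtain ⟨z, hz⟩ := cauchySeq_tendsto_of_complete hcau
  have hy : Tendsto (fun n => T^[n] x) atTop (𝓝 (z + p)) := by simpa using hz.add_const p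
  have hyC : z + p ∈ C := hCcl.mem_of_tendsto hy (Eventually.of_forall hmem)
  refine ⟨z + p, hyC, ?_, hy⟩
  have hlim : Tendsto (fun n => T^[n + 1] x) atTop (𝓝 (T (z + p))) := by
    refine tendsto_iff_norm_sub_tendsto_zero.2 (squeeze_zero (fun _ => norm_nonneg _) (fun n => ?_)
      (by simpa using (tendsto_iff_norm_sub_tendsto_zero.1 hy).const_mul (μ 1)))
    simpa [Function.iterate_succ_apply'] using hane _ (hmem n) _ hyC 1
  exact tendsto_nhds_unique hlim ((tendsto_add_atTop_iff_nat 1).2 hy)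
end

section
/- Let X be a uniformly convex Banach space, d > 0 and h ∈ (0,1). Then for every ε > 0 there exists δ₀ > 0 such that for all δ ∈ (0, δ₀] and all c, c' ∈ X with ‖c − c'‖ = h·d, the diameter of the set B_{d−hd+δ}[c] ∩ (X ∖ B°_d[c']) is at most ε; in particular this convergence of diameters to 0 as δ → 0 is uniform in c and c'. -/
/-- If `u` lies almost in the ball of radius `r` and `‖u + v‖ ≥ r + ‖v‖`, then `u` is almost as far
as possible from the antipode of the point of norm `r` in the direction of `v`. -/
theorem two_mul_sub_le_norm_add_smul {X : Type*} [NormedAddCommGroup X] [NormedSpace ℝ X]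
    {r δ : ℝ} (hr : 0 ≤ r) (hδ : 0 ≤ δ) {u v : X} (hv : 0 < ‖v‖) (hu : ‖u‖ ≤ r + δ)
    (huv : r + ‖v‖ ≤ ‖u + v‖) :
    2 * r - r / ‖v‖ * δ ≤ ‖u + (r / ‖v‖) • v‖ := by
  have ht : 0 ≤ r / ‖v‖ := by positivity
  have hta : r / ‖v‖ * ‖v‖ = r := div_mul_cancel₀ _ hv.ne'
  set t := r / ‖v‖
  rcases le_total t 1 with h1 | h1
  · have e : u + v = (u + t • v) + (1 - t) • v := by module
    have h2 := norm_add_le (u + t • v) ((1 - t) • v)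
    rw [← e, norm_smul_of_nonneg (sub_nonneg.2 h1)] at h2
    nlinarith [mul_nonneg ht hδ]
  · have e : t • (u + v) = (u + t • v) + (t - 1) • u := by module
    have h2 := norm_add_le (u + t • v) ((t - 1) • u)
    rw [← e, norm_smul_of_nonneg ht, norm_smul_of_nonneg (sub_nonneg.2 h1)] at h2
    have h3 := mul_le_mul_of_nonneg_left huv ht
    have h4 := mul_le_mul_of_nonneg_left hu (sub_nonneg.2 h1)
    nlinarith

/-- In a uniformly convex space, a vector `u` almost in the ball of radius `r` with
`‖u + v‖ ≥ r + ‖v‖` is close to the vector of norm `r` in the direction of `v`, uniformly in `v` of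
given norm. -/
theorem exists_forall_norm_sub_smul_le (X : Type*) [NormedAddCommGroup X] [NormedSpace ℝ X]
    [UniformConvexSpace X] {a r ε : ℝ} (ha : 0 < a) (hr : 0 < r) (hε : 0 < ε) :
    ∃ δ₀ > (0 : ℝ), ∀ δ ∈ Set.Ioc (0 : ℝ) δ₀, ∀ u v : X, ‖v‖ = a → ‖u‖ ≤ r + δ →
      r + a ≤ ‖u + v‖ → ‖u - (r / a) • v‖ ≤ ε := by
  obtain ⟨η, hη, H⟩ := exists_forall_closed_ball_dist_add_le_two_mul_sub X (half_pos hε) r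
  have ht : 0 < r / a + 1 := by positivity
  refine ⟨min (ε / 2) (η / 2 / (r / a + 1)), by positivity, ?_⟩
  rintro δ ⟨hδ, hδ'⟩ u v rfl hu huv
  obtain ⟨hδε, hδη⟩ := le_min_iff.1 hδ'
  rw [le_div_iff₀ ht] at hδη
  have hlow := two_mul_sub_le_norm_add_smul hr.le hδ.le ha hu huv
  have hw : ‖(r / ‖v‖) • v‖ = r := by
    rw [norm_smul_of_nonneg (by positivity), div_mul_cancel₀ _ ha.ne']
  set w := (r / ‖v‖) • v
  have hrδ : 0 < r + δ := by positivity
  have hu' : ‖(r / (r + δ)) • u‖ ≤ r := by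
    rw [norm_smul_of_nonneg (by positivity), div_mul_eq_mul_div, div_le_iff₀ hrδ]
    gcongr
  have hd : ‖u - (r / (r + δ)) • u‖ ≤ δ := by
    have e : u - (r / (r + δ)) • u = (δ / (r + δ)) • u := by
      have : δ / (r + δ) = 1 - r / (r + δ) := by field_simp; ring
      rw [this]; module
    rw [e, norm_smul_of_nonneg (by positivity), div_mul_eq_mul_div, div_le_iff₀ hrδ]
    gcongr
  set u' := (r / (r + δ)) • u
  have hclose : ‖u' - w‖ < ε / 2 := by
    by_contra! hc
    have h1 := H hu' hw.le hc
    have h2 := norm_add_le (u' + w) (u - u')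
    rw [show u' + w + (u - u') = u + w by abel] at h2
    nlinarith
  have h3 := norm_add_le (u - u') (u' - w)
  rw [sub_add_sub_cancel] at h3
  linarith

/-- Let `X` be a uniformly convex Banach space, `d > 0` and `h ∈ (0,1)`.  Then for every
`ε > 0` there exists `δ₀ > 0` such that for all `δ ∈ (0, δ₀]` and all `c, c' ∈ X` with
`‖c - c'‖ = h·d`, the diameter of `B_{d-hd+δ}[c] ∩ (X \ B°_d[c'])` is at most `ε`
(uniformly in `c, c'`). -/
theorem stmt7 {X : Type*} [NormedAddCommGroup X] [NormedSpace ℝ X]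
    [UniformConvexSpace X] [CompleteSpace X]
    (d : ℝ) (hd : 0 < d) (h : ℝ) (hh : h ∈ Set.Ioo (0 : ℝ) 1) :
    ∀ ε > (0 : ℝ), ∃ δ₀ > (0 : ℝ), ∀ δ ∈ Set.Ioc (0 : ℝ) δ₀, ∀ c c' : X,
      ‖c - c'‖ = h * d →
        EMetric.diam (Metric.closedBall c (d - h * d + δ) ∩ (Metric.ball c' d)ᶜ) ≤
          ENNReal.ofReal ε := by
  intro ε hε
  obtain ⟨h0, h1⟩ := hh
  have hr : 0 < d - h * d := by nlinarith
  obtain ⟨δ₀, hδ₀, H⟩ := exists_forall_norm_sub_smul_le X (mul_pos h0 hd) hr (half_pos hε)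
  refine ⟨δ₀, hδ₀, fun δ hδ c c' hc => Metric.ediam_le fun x hx y hy => ?_⟩
  have key : ∀ z ∈ Metric.closedBall c (d - h * d + δ) ∩ (Metric.ball c' d)ᶜ,
      dist (z - c) (((d - h * d) / (h * d)) • (c - c')) ≤ ε / 2 := by
    rintro z ⟨hz, hz'⟩
    rw [mem_closedBall_iff_norm] at hz
    rw [Set.mem_compl_iff, mem_ball_iff_norm, not_lt] at hz'
    rw [dist_eq_norm]
    exact H δ hδ _ _ hc hz (by simpa using hz')
  rw [edist_dist, ← dist_sub_right x y c]
  exact ENNReal.ofReal_le_ofReal <|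
    (dist_triangle_right _ _ _).trans <| (add_le_add (key x hx) (key y hy)).trans (add_halves ε).le
end

section
/- Suppose Φ : (0,2] → (0,1] is a modulus of uniform convexity for the Banach space X, and define Ψ(h, ε) := min(ε/2, 2h·Φ(ε/2)) for h ∈ (0, 1/2) and ε ∈ (0,4]. Then for all y in the closed unit ball B of X, all u ∈ X, all h ∈ (0, 1/2) and all ε ∈ (0,4]: if ‖u − h·y‖ ≤ 1 − h + Ψ(h, ε) and ‖u‖ ≥ 1, then ‖u − y‖ ≤ ε. -/
/-- Suppose `Φ : (0,2] → (0,1]` is a modulus of uniform convexity for the Banach space `X`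
and `Ψ(h,ε) := min (ε/2) (2h·Φ(ε/2))`.  Then for all `y` in the closed unit ball, `u ∈ X`,
`h ∈ (0,1/2)` and `ε ∈ (0,4]`: if `‖u - h·y‖ ≤ 1 - h + Ψ(h,ε)` and `‖u‖ ≥ 1`, then
`‖u - y‖ ≤ ε`. -/
theorem stmt8 {X : Type*} [NormedAddCommGroup X] [NormedSpace ℝ X] [CompleteSpace X]
    (Φ : ℝ → ℝ) (hΦrange : ∀ ε ∈ Set.Ioc (0 : ℝ) 2, Φ ε ∈ Set.Ioc (0 : ℝ) 1)
    (hΦ : ∀ x₁ x₂ : X, ‖x₁‖ ≤ 1 → ‖x₂‖ ≤ 1 → ∀ ε ∈ Set.Ioc (0 : ℝ) 2,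
      (1 : ℝ) / 2 * ‖x₁ + x₂‖ ≥ 1 - Φ ε → ‖x₁ - x₂‖ ≤ ε)
    (y u : X) (hy : ‖y‖ ≤ 1) (h : ℝ) (hh : h ∈ Set.Ioo (0 : ℝ) (1 / 2))
    (ε : ℝ) (hε : ε ∈ Set.Ioc (0 : ℝ) 4)
    (h1 : ‖u - h • y‖ ≤ 1 - h + min (ε / 2) (2 * h * Φ (ε / 2)))
    (h2 : 1 ≤ ‖u‖) :
    ‖u - y‖ ≤ ε := by
  obtain ⟨hh0, hh1⟩ := hh
  obtain ⟨hε0, hε4⟩ := hε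
  have hmin₁ := min_le_left (ε / 2) (2 * h * Φ (ε / 2))
  have hmin₂ := min_le_right (ε / 2) (2 * h * Φ (ε / 2))
  obtain ⟨v, rfl⟩ : ∃ v, u = v + h • y := ⟨u - h • y, by simp⟩
  rw [add_sub_cancel_right] at h1
  have hhy : ‖h • y‖ ≤ h := by
    rw [norm_smul, Real.norm_of_nonneg hh0.le]
    exact mul_le_of_le_one_right hh0.le hy
  have hv : 1 - h ≤ ‖v‖ := by linarith [norm_add_le v (h • y)]
  have hv0 : ‖v‖ ≠ 0 := by linarith
  obtain ⟨x, hx, hvx⟩ : ∃ x : X, ‖x‖ = 1 ∧ v = ‖v‖ • x :=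
    ⟨‖v‖⁻¹ • v, by rw [norm_smul, norm_inv, norm_norm, inv_mul_cancel₀ hv0],
      (smul_inv_smul₀ hv0 v).symm⟩
  generalize ‖v‖ = r at *
  subst hvx
  have hsum : ‖r • x + h • y‖ ≤ h * ‖x + y‖ + (r - h) := by
    calc ‖r • x + h • y‖ = ‖h • (x + y) + (r - h) • x‖ := by congr 1; module
      _ ≤ ‖h • (x + y)‖ + ‖(r - h) • x‖ := norm_add_le _ _
      _ = h * ‖x + y‖ + (r - h) := by
        rw [norm_smul, norm_smul, hx, Real.norm_of_nonneg hh0.le,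
          Real.norm_of_nonneg (by linarith), mul_one]
  have hmid : (1 : ℝ) / 2 * ‖x + y‖ ≥ 1 - Φ (ε / 2) := by
    have : h * (2 - 2 * Φ (ε / 2)) ≤ h * ‖x + y‖ := by linarith
    linarith [le_of_mul_le_mul_left this hh0]
  have hxy : ‖x - y‖ ≤ ε / 2 :=
    hΦ x y hx.le hy (ε / 2) ⟨by linarith, by linarith⟩ hmid
  calc ‖r • x + h • y - y‖ = ‖(1 - h) • (x - y) + (r - (1 - h)) • x‖ := by
        congr 1; module
    _ ≤ ‖(1 - h) • (x - y)‖ + ‖(r - (1 - h)) • x‖ := norm_add_le _ _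
    _ = (1 - h) * ‖x - y‖ + (r - (1 - h)) := by
        rw [norm_smul, norm_smul, hx, Real.norm_of_nonneg (by linarith),
          Real.norm_of_nonneg (by linarith), mul_one]
    _ ≤ ε := by nlinarith [norm_nonneg (x - y)]
end

section
/- Let Φ : (0,2] → (0,1] be a modulus of uniform convexity for the Banach space X, let K > 0, r > 0 with r/K ≤ 2 (so that h below lies in (0,1/2)), let ε > 0 with ε/(2K) ∈ (0,4], and set h := min(1/4, r/K), δ := min(1, Ψ(h, ε/(2K))) where Ψ(h, ε') := min(ε'/2, 2h·Φ(ε'/2)). Suppose d ∈ ℝ and u, y ∈ X satisfy: (a) 0 < d ≤ K, (b) ‖y‖ = d, (c) ‖u‖ ≥ d, and (d) ‖u − h·y‖ ≤ d(1 − h + δ). Then ‖u − y‖ ≤ ε/2. -/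
/-- If `y` is a unit vector, `‖u‖ ≥ 1` and `u` is within `1 - h + δ` of `h • y`, then `u` is close
to `y`, provided that midpoints of norm at least `1 - φ` come from `η`-close points of the ball. -/
theorem norm_sub_le_of_norm_sub_smul_le {X : Type*} [NormedAddCommGroup X] [NormedSpace ℝ X]
    {φ η h δ : ℝ} {u y : X}
    (hφ : ∀ x₁ x₂ : X, ‖x₁‖ ≤ 1 → ‖x₂‖ ≤ 1 →
      (1 : ℝ) / 2 * ‖x₁ + x₂‖ ≥ 1 - φ → ‖x₁ - x₂‖ ≤ η)
    (hpos : 0 < h) (h1 : 2 * h ≤ 1) (hδ0 : 0 ≤ δ) (hδη : δ ≤ η)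
    (hδφ : δ ≤ 2 * h * φ) (hy : ‖y‖ = 1) (hu : 1 ≤ ‖u‖)
    (huy : ‖u - h • y‖ ≤ 1 - h + δ) :
    ‖u - y‖ ≤ 2 * η := by
  have hc : 0 < 1 - h + δ := by linarith
  obtain ⟨w, hw⟩ : ∃ w : X, (1 - h + δ) • w = u - h • y :=
    ⟨(1 - h + δ)⁻¹ • (u - h • y), smul_inv_smul₀ hc.ne' _⟩
  have hw1 : ‖w‖ ≤ 1 := by
    rw [← hw, norm_smul, Real.norm_of_nonneg hc.le] at huy
    exact le_of_mul_le_mul_left (by linarith) hc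
  have hwy : ‖w - y‖ ≤ η := by
    refine hφ w y hw1 hy.le ?_
    have hu' : u = (1 - 2 * h + δ) • w + h • (w + y) := by
      rw [eq_add_of_sub_eq hw.symm]; module
    have hle : ‖u‖ ≤ (1 - 2 * h + δ) * ‖w‖ + h * ‖w + y‖ := by
      rw [hu']
      refine (norm_add_le _ _).trans_eq ?_
      rw [norm_smul, norm_smul, Real.norm_of_nonneg (by linarith), Real.norm_of_nonneg hpos.le]
    have hmul : (1 - 2 * h + δ) * ‖w‖ ≤ 1 - 2 * h + δ :=
      mul_le_of_le_one_right (by linarith) hw1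
    refine le_of_mul_le_mul_left ?_ hpos
    linarith
  have hsub : u - y = (1 - h) • (w - y) + δ • w := by
    rw [eq_add_of_sub_eq hw.symm]; module
  have hle : ‖u - y‖ ≤ (1 - h) * ‖w - y‖ + δ * ‖w‖ := by
    rw [hsub]
    refine (norm_add_le _ _).trans_eq ?_
    rw [norm_smul, norm_smul, Real.norm_of_nonneg (by linarith), Real.norm_of_nonneg hδ0]
  have hfst : (1 - h) * ‖w - y‖ ≤ 1 * η :=
    mul_le_mul (by linarith) hwy (norm_nonneg _) zero_le_one
  have hsnd : δ * ‖w‖ ≤ δ := mul_le_of_le_one_right hδ0 hw1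
  linarith

/-- Quantitative uniform convexity lemma: with `Φ` a modulus of uniform convexity for `X`,
`h := min (1/4) (r/K)`, `δ := min 1 (Ψ h (ε/(2K)))` where `Ψ h ε' := min (ε'/2) (2h·Φ(ε'/2))`,
if `0 < d ≤ K`, `‖y‖ = d`, `‖u‖ ≥ d` and `‖u - h·y‖ ≤ d(1 - h + δ)`, then `‖u - y‖ ≤ ε/2`. -/
theorem stmt10 {X : Type*} [NormedAddCommGroup X] [NormedSpace ℝ X] [CompleteSpace X]
    (Φ : ℝ → ℝ) (hΦrange : ∀ ε ∈ Set.Ioc (0 : ℝ) 2, Φ ε ∈ Set.Ioc (0 : ℝ) 1)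
    (hΦ : ∀ x₁ x₂ : X, ‖x₁‖ ≤ 1 → ‖x₂‖ ≤ 1 → ∀ ε ∈ Set.Ioc (0 : ℝ) 2,
      (1 : ℝ) / 2 * ‖x₁ + x₂‖ ≥ 1 - Φ ε → ‖x₁ - x₂‖ ≤ ε)
    (K r : ℝ) (hK : 0 < K) (hr : 0 < r) (hrK : r / K ≤ 2)
    (ε : ℝ) (hε : 0 < ε) (hε2K : ε / (2 * K) ∈ Set.Ioc (0 : ℝ) 4)
    (d : ℝ) (u y : X)
    (ha : 0 < d ∧ d ≤ K) (hb : ‖y‖ = d) (hc : d ≤ ‖u‖)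
    (hd : ‖u - min (1 / 4 : ℝ) (r / K) • y‖ ≤
      d * (1 - min (1 / 4 : ℝ) (r / K) +
        min 1 (min (ε / (2 * K) / 2)
          (2 * min (1 / 4 : ℝ) (r / K) * Φ (ε / (2 * K) / 2))))) :
    ‖u - y‖ ≤ ε / 2 := by
  obtain ⟨hd0, hdK⟩ := ha
  have hη : ε / (2 * K) / 2 ∈ Set.Ioc (0 : ℝ) 2 :=
    ⟨half_pos hε2K.1, by linarith [hε2K.2]⟩
  have hφ0 := (hΦrange _ hη).1
  have hh : 0 < min (1 / 4 : ℝ) (r / K) := lt_min (by norm_num) (div_pos hr hK)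
  have hh4 : min (1 / 4 : ℝ) (r / K) ≤ 1 / 4 := min_le_left _ _
  have hscale := norm_sub_le_of_norm_sub_smul_le (u := d⁻¹ • u) (y := d⁻¹ • y)
    (fun x₁ x₂ hx₁ hx₂ => hΦ x₁ x₂ hx₁ hx₂ _ hη) hh (by linarith)
    (le_min zero_le_one (le_min hη.1.le (by positivity)))
    ((min_le_right _ _).trans (min_le_left _ _)) ((min_le_right _ _).trans (min_le_right _ _))
    (by rw [norm_smul, norm_inv, Real.norm_of_nonneg hd0.le, hb, inv_mul_cancel₀ hd0.ne'])
    (by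
      rw [norm_smul, norm_inv, Real.norm_of_nonneg hd0.le]
      exact (le_inv_mul_iff₀ hd0).2 (by linarith))
    (by
      rw [smul_comm, ← smul_sub, norm_smul, norm_inv, Real.norm_of_nonneg hd0.le]
      exact (inv_mul_le_iff₀ hd0).2 hd)
  rw [← smul_sub, norm_smul, norm_inv, Real.norm_of_nonneg hd0.le, inv_mul_le_iff₀ hd0] at hscale
  calc ‖u - y‖ ≤ d * (2 * (ε / (2 * K) / 2)) := hscale
    _ ≤ K * (2 * (ε / (2 * K) / 2)) :=
      mul_le_mul_of_nonneg_right hdK (mul_nonneg zero_le_two hη.1.le)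
    _ = ε / 2 := by field_simp
end

section
/- Let Φ be a modulus of uniform convexity for the Banach space X, let T : C → C (C ⊆ X) with closed ball B_r[p] ⊆ Fix(T), x ∈ C with ‖x − p‖ < K, ε > 0 with ε/(2K) ∈ (0,4], and r/K ≤ 2. Set h := min(1/4, r/K), δ := min(1, Ψ(h, ε/(2K))) with Ψ(h, ε') := min(ε'/2, 2h·Φ(ε'/2)), and η := r·δ/4. Fix g : ℕ → ℕ and suppose N, n ∈ ℕ satisfy: (i) ‖T^N x − p‖ − η ≤ ‖T^i x − p‖ for all i ≤ n + g(n), and (ii) for all q ∈ B_r[p] and all i ∈ [n, n + g(n)], ‖T^i x − q‖ ≤ ‖T^N x − q‖ + η. Assume moreover ‖T^N x − p‖ ≥ r. Define d := ‖T^N x − p‖ − η and y := d·(T^N x − p)/‖T^N x − p‖. Then ‖T^i x − (p + y)‖ ≤ ε/2 for all i ∈ [n, n + g(n)]. -/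
/-- Near equality in the triangle inequality forces alignment: if `Φ` is a modulus of convexity
at `e`, `u` and `v` lie in the unit ball, and `‖s • u + t • v‖` is within `2 * s * Φ` of
`s + t`, where `s ≤ t`, then `u` and `v` are `e`-close. -/
theorem norm_sub_le_of_add_sub_le_norm_smul_add_smul {X : Type*} [NormedAddCommGroup X]
    [NormedSpace ℝ X] {φ e s t : ℝ} {u v : X}
    (hφ : ∀ x₁ x₂ : X, ‖x₁‖ ≤ 1 → ‖x₂‖ ≤ 1 →
      (1 : ℝ) / 2 * ‖x₁ + x₂‖ ≥ 1 - φ → ‖x₁ - x₂‖ ≤ e)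
    (hs : 0 < s) (hst : s ≤ t) (hu : ‖u‖ ≤ 1) (hv : ‖v‖ ≤ 1)
    (h : s + t - 2 * s * φ ≤ ‖s • u + t • v‖) : ‖u - v‖ ≤ e := by
  refine hφ u v hu hv ?_
  have hsplit : s • u + t • v = s • (u + v) + (t - s) • v := by module
  have htri : ‖s • u + t • v‖ ≤ s * ‖u + v‖ + (t - s) * ‖v‖ := by
    rw [hsplit]
    refine (norm_add_le _ _).trans_eq ?_
    rw [norm_smul_of_nonneg hs.le, norm_smul_of_nonneg (sub_nonneg.2 hst)]
  have hv' : (t - s) * ‖v‖ ≤ t - s := mul_le_of_le_one_right (sub_nonneg.2 hst) hv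
  have : s * (2 * (1 - φ)) ≤ s * ‖u + v‖ := by linarith
  linarith [le_of_mul_le_mul_left this hs]

/-- If `b` is not much shorter than `a`, and not much further than `a` from any point of the ball
of radius `r ≤ ‖a‖` about the origin, then `b` is close to the multiple of `a` of norm
`‖a‖ - η`. -/
theorem norm_sub_smul_le_of_norm_sub_le {X : Type*} [NormedAddCommGroup X] [NormedSpace ℝ X]
    {φ e r K η : ℝ} {a b : X}
    (hφ : ∀ x₁ x₂ : X, ‖x₁‖ ≤ 1 → ‖x₂‖ ≤ 1 →
      (1 : ℝ) / 2 * ‖x₁ + x₂‖ ≥ 1 - φ → ‖x₁ - x₂‖ ≤ e)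
    (hr : 0 < r) (hη : 0 ≤ η) (hηr : 4 * η ≤ r) (hηφ : 2 * η ≤ r * φ)
    (hηe : 2 * η ≤ K * e) (hra : r ≤ ‖a‖) (haK : ‖a‖ - η ≤ K) (hab : ‖a‖ - η ≤ ‖b‖)
    (hball : ∀ q : X, ‖q‖ ≤ r → ‖b - q‖ ≤ ‖a - q‖ + η) :
    ‖b - ((‖a‖ - η) / ‖a‖) • a‖ ≤ 2 * K * e := by
  have ha : 0 < ‖a‖ := hr.trans_le hra
  obtain ⟨u, hu, hau⟩ : ∃ u : X, ‖u‖ = 1 ∧ a = ‖a‖ • u :=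
    ⟨‖a‖⁻¹ • a, by rw [norm_smul, norm_inv, norm_norm, inv_mul_cancel₀ ha.ne'],
      by rw [smul_inv_smul₀ ha.ne']⟩
  generalize ‖a‖ = D at *
  obtain ⟨s, rfl⟩ : ∃ s, r = 2 * s := ⟨r / 2, by ring⟩
  obtain ⟨R, hR⟩ : ∃ R, R = D - s + η := ⟨_, rfl⟩
  have hs : 0 < s := by linarith
  have hsR : s ≤ R := by linarith
  have hR0 : 0 < R := hs.trans_le hsR
  have hbR : ‖b - s • u‖ ≤ R := by
    refine (hball (s • u) ?_).trans_eq ?_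
    · rw [norm_smul_of_nonneg hs.le, hu]; linarith
    · rw [hau, ← sub_smul, norm_smul_of_nonneg (by linarith), hu, hR, mul_one]
  obtain ⟨v, hv⟩ : ∃ v : X, b = s • u + R • v :=
    ⟨R⁻¹ • (b - s • u), by rw [smul_inv_smul₀ hR0.ne']; abel⟩
  have hv1 : ‖v‖ ≤ 1 := by
    rw [hv, add_sub_cancel_left, norm_smul_of_nonneg hR0.le] at hbR
    exact le_of_mul_le_mul_left (by linarith) hR0
  have huv : ‖u - v‖ ≤ e :=
    norm_sub_le_of_add_sub_le_norm_smul_add_smul hφ hs hsR hu.le hv1 (by rw [← hv]; linarith)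
  have hdiff : b - ((D - η) / D) • a = (2 * η) • u - R • (u - v) := by
    rw [hau, smul_smul, div_mul_cancel₀ _ ha.ne', hv, hR]; module
  calc ‖b - ((D - η) / D) • a‖ ≤ 2 * η * ‖u‖ + R * ‖u - v‖ := by
        rw [hdiff, ← norm_smul_of_nonneg (by positivity) u, ← norm_smul_of_nonneg hR0.le]
        exact norm_sub_le _ _
    _ ≤ K * e + K * e := by
        rw [hu, mul_one]
        exact add_le_add hηe (mul_le_mul (by linarith) huv (norm_nonneg _) (by linarith))
    _ = 2 * K * e := by ring


/-- Lemma tying together the quantitative lemmas: with `Φ` a modulus of uniform convexity,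
`h := min (1/4) (r/K)`, `δ := min 1 (Ψ h (ε/(2K)))`, `η := r·δ/4`, if `N, n` satisfy
conditions (i) and (ii), and `‖T^N x - p‖ ≥ r`, then setting `d := ‖T^N x - p‖ - η` and
`y := d·(T^N x - p)/‖T^N x - p‖` we have `‖T^i x - (p + y)‖ ≤ ε/2` for all
`i ∈ [n, n + g n]`. -/
theorem stmt12 {X : Type*} [NormedAddCommGroup X] [NormedSpace ℝ X] [CompleteSpace X]
    (Φ : ℝ → ℝ) (hΦrange : ∀ ε ∈ Set.Ioc (0 : ℝ) 2, Φ ε ∈ Set.Ioc (0 : ℝ) 1)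
    (hΦ : ∀ x₁ x₂ : X, ‖x₁‖ ≤ 1 → ‖x₂‖ ≤ 1 → ∀ ε ∈ Set.Ioc (0 : ℝ) 2,
      (1 : ℝ) / 2 * ‖x₁ + x₂‖ ≥ 1 - Φ ε → ‖x₁ - x₂‖ ≤ ε)
    (C : Set X) (T : X → X) (hT : Set.MapsTo T C C)
    (p : X) (r : ℝ) (hr : 0 < r)
    (hball : Metric.closedBall p r ⊆ {y | y ∈ C ∧ T y = y})
    (x : X) (hx : x ∈ C) (K : ℝ) (hK : 0 < K) (hxp : ‖x - p‖ < K)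
    (ε : ℝ) (hε : 0 < ε) (hε2K : ε / (2 * K) ∈ Set.Ioc (0 : ℝ) 4) (hrK : r / K ≤ 2)
    (g : ℕ → ℕ) (N n : ℕ)
    (hi : ∀ i ≤ n + g n,
      ‖T^[N] x - p‖ - r * min 1 (min (ε / (2 * K) / 2)
          (2 * min (1 / 4 : ℝ) (r / K) * Φ (ε / (2 * K) / 2))) / 4 ≤ ‖T^[i] x - p‖)
    (hii : ∀ q ∈ Metric.closedBall p r, ∀ i ∈ Set.Icc n (n + g n),
      ‖T^[i] x - q‖ ≤ ‖T^[N] x - q‖ + r * min 1 (min (ε / (2 * K) / 2)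
          (2 * min (1 / 4 : ℝ) (r / K) * Φ (ε / (2 * K) / 2))) / 4)
    (hN : r ≤ ‖T^[N] x - p‖) :
    ∀ i ∈ Set.Icc n (n + g n),
      ‖T^[i] x - (p + ((‖T^[N] x - p‖ - r * min 1 (min (ε / (2 * K) / 2)
            (2 * min (1 / 4 : ℝ) (r / K) * Φ (ε / (2 * K) / 2))) / 4) / ‖T^[N] x - p‖) •
          (T^[N] x - p))‖ ≤ ε / 2 := by
  intro i hin
  have hε4 : ε / (2 * K) / 2 ∈ Set.Ioc (0 : ℝ) 2 :=
    ⟨half_pos hε2K.1, by linarith [hε2K.2]⟩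
  obtain ⟨hΦpos, -⟩ := hΦrange _ hε4
  have hεK : ε / 2 = 2 * K * (ε / (2 * K) / 2) := by field_simp
  have hrK2 : r ≤ 2 * K := (div_le_iff₀ hK).1 hrK
  rw [hεK]
  generalize ε / (2 * K) / 2 = e at *
  have he : 0 < e := hε4.1
  have hh : 0 < min (1 / 4 : ℝ) (r / K) := lt_min (by norm_num) (div_pos hr hK)
  have hh4 : min (1 / 4 : ℝ) (r / K) ≤ 1 / 4 := min_le_left _ _
  generalize min (1 / 4 : ℝ) (r / K) = h at *
  have hδ0 : 0 < min 1 (min e (2 * h * Φ e)) :=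
    lt_min one_pos (lt_min he (by positivity))
  have hδ1 : min 1 (min e (2 * h * Φ e)) ≤ 1 := min_le_left _ _
  have hδe : min 1 (min e (2 * h * Φ e)) ≤ e := (min_le_right _ _).trans (min_le_left _ _)
  have hδΦ : min 1 (min e (2 * h * Φ e)) ≤ Φ e :=
    ((min_le_right _ _).trans (min_le_right _ _)).trans (by nlinarith)
  generalize min 1 (min e (2 * h * Φ e)) = δ at *
  rw [← sub_sub]
  have hx0 := hi 0 (Nat.zero_le _)
  rw [Function.iterate_zero_apply] at hx0
  refine norm_sub_smul_le_of_norm_sub_le (r := r)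
    (fun x₁ x₂ h₁ h₂ => hΦ x₁ x₂ h₁ h₂ e hε4) hr (by positivity) ?_ ?_ ?_ hN
    (hx0.trans hxp.le) (hi i hin.2) fun q hq => ?_
  · nlinarith
  · nlinarith
  · nlinarith
  · rw [sub_sub, sub_sub]
    exact hii (p + q) (by simpa [dist_eq_norm] using hq) i hin
end

section
/- Under the hypotheses of the preceding statement (Φ a modulus of uniform convexity for X, B_r[p] ⊆ Fix(T), ‖x − p‖ < K, ε/(2K) ∈ (0,4], r/K ≤ 2, η := (r/4)·min(1, Ψ(min(1/4, r/K), ε/(2K))), N and n satisfying conditions (i) and (ii) for this η and a given g : ℕ → ℕ, and ‖T^N x − p‖ ≥ r), it follows that ‖T^i x − T^j x‖ ≤ ε for all i, j ∈ [n, n + g(n)]. -/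
/-- In a uniformly convex space, a vector `u` of norm almost `‖w‖` that is hardly farther than `w`
from the point `q` of norm `r / 2` on the ray through `w` is close to a multiple of `w`. -/
theorem norm_sub_smul_le_of_almost_aligned {X : Type*} [NormedAddCommGroup X] [NormedSpace ℝ X]
    {φ d : ℝ}
    (hφ : ∀ x₁ x₂ : X, ‖x₁‖ ≤ 1 → ‖x₂‖ ≤ 1 → (1 : ℝ) / 2 * ‖x₁ + x₂‖ ≥ 1 - φ → ‖x₁ - x₂‖ ≤ d)
    {r η : ℝ} (hr : 0 < r) (hη : 0 ≤ η) (hηφ : 2 * η ≤ r * φ) {w u : X} (hw : r ≤ ‖w‖)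
    (hu : ‖w‖ - η ≤ ‖u‖)
    (huq : ‖u - (r / 2) • ‖w‖⁻¹ • w‖ ≤ ‖w‖ - r / 2 + η) :
    ‖u - (‖w‖ + η) • ‖w‖⁻¹ • w‖ ≤ (‖w‖ - r / 2 + η) * d := by
  have hw0 : 0 < ‖w‖ := hr.trans_le hw
  set b : X := ‖w‖⁻¹ • w with hb
  have hb1 : ‖b‖ = 1 := by
    rw [hb, norm_smul, norm_inv, norm_norm, inv_mul_cancel₀ hw0.ne']
  set t : ℝ := ‖w‖ - r / 2 + η with ht
  have ht0 : 0 < t := by linarith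
  set a : X := t⁻¹ • (u - (r / 2) • b) with ha
  have hta : t • a = u - (r / 2) • b := by rw [ha, smul_inv_smul₀ ht0.ne']
  have ha1 : ‖a‖ ≤ 1 := by
    rw [ha, norm_smul, norm_inv, Real.norm_of_nonneg ht0.le]
    exact (inv_mul_le_one₀ ht0).2 huq
  have hsum : ‖u‖ ≤ r / 2 * ‖a + b‖ + (t - r / 2) := by
    have h : u = (r / 2) • (a + b) + (t - r / 2) • a := by
      rw [sub_smul, hta, smul_add]; abel
    have hts : 0 ≤ t - r / 2 := by linarith
    calc ‖u‖ ≤ ‖(r / 2) • (a + b)‖ + ‖(t - r / 2) • a‖ := by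
          conv_lhs => rw [h]
          exact norm_add_le _ _
      _ = r / 2 * ‖a + b‖ + (t - r / 2) * ‖a‖ := by
          rw [norm_smul, norm_smul, Real.norm_of_nonneg hts, Real.norm_of_nonneg (by positivity)]
      _ ≤ _ := by gcongr; exact mul_le_of_le_one_right hts ha1
  have hab : ‖a - b‖ ≤ d := by
    refine hφ a b ha1 hb1.le ?_
    refine le_of_mul_le_mul_left ?_ hr
    linarith
  have h : u - (‖w‖ + η) • b = t • (a - b) := by
    rw [smul_sub, hta, ht]; module
  rw [h, norm_smul, Real.norm_of_nonneg ht0.le]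
  gcongr


/-- Under the hypotheses of the preceding quantitative lemma (with
`η := (r/4)·min 1 (Ψ (min (1/4) (r/K)) (ε/(2K)))`, `N, n` satisfying conditions (i) and
(ii), and `‖T^N x - p‖ ≥ r`), we have `‖T^i x - T^j x‖ ≤ ε` for all `i, j ∈ [n, n + g n]`. -/
theorem stmt13 {X : Type*} [NormedAddCommGroup X] [NormedSpace ℝ X] [CompleteSpace X]
    (Φ : ℝ → ℝ) (hΦrange : ∀ ε ∈ Set.Ioc (0 : ℝ) 2, Φ ε ∈ Set.Ioc (0 : ℝ) 1)
    (hΦ : ∀ x₁ x₂ : X, ‖x₁‖ ≤ 1 → ‖x₂‖ ≤ 1 → ∀ ε ∈ Set.Ioc (0 : ℝ) 2,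
      (1 : ℝ) / 2 * ‖x₁ + x₂‖ ≥ 1 - Φ ε → ‖x₁ - x₂‖ ≤ ε)
    (C : Set X) (T : X → X) (hT : Set.MapsTo T C C)
    (p : X) (r : ℝ) (hr : 0 < r)
    (hball : Metric.closedBall p r ⊆ {y | y ∈ C ∧ T y = y})
    (x : X) (hx : x ∈ C) (K : ℝ) (hK : 0 < K) (hxp : ‖x - p‖ < K)
    (ε : ℝ) (hε : 0 < ε) (hε2K : ε / (2 * K) ∈ Set.Ioc (0 : ℝ) 4) (hrK : r / K ≤ 2)
    (g : ℕ → ℕ) (N n : ℕ)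
    (hi : ∀ i ≤ n + g n,
      ‖T^[N] x - p‖ - r / 4 * min 1 (min (ε / (2 * K) / 2)
          (2 * min (1 / 4 : ℝ) (r / K) * Φ (ε / (2 * K) / 2))) ≤ ‖T^[i] x - p‖)
    (hii : ∀ q ∈ Metric.closedBall p r, ∀ i ∈ Set.Icc n (n + g n),
      ‖T^[i] x - q‖ ≤ ‖T^[N] x - q‖ + r / 4 * min 1 (min (ε / (2 * K) / 2)
          (2 * min (1 / 4 : ℝ) (r / K) * Φ (ε / (2 * K) / 2))))
    (hN : r ≤ ‖T^[N] x - p‖) :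
    ∀ i ∈ Set.Icc n (n + g n), ∀ j ∈ Set.Icc n (n + g n),
      ‖T^[i] x - T^[j] x‖ ≤ ε := by
  have hδ : 0 < ε / (2 * K) := hε2K.1
  have hδ2 : ε / (2 * K) / 2 ∈ Set.Ioc (0 : ℝ) 2 := ⟨by linarith, by linarith [hε2K.2]⟩
  have hΦpos : 0 < Φ (ε / (2 * K) / 2) := (hΦrange _ hδ2).1
  set φ : ℝ := Φ (ε / (2 * K) / 2)
  set d : ℝ := ε / (2 * K) / 2 with hd
  set η : ℝ := r / 4 * min 1 (min d (2 * min (1 / 4 : ℝ) (r / K) * φ)) with hη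
  have hd0 : 0 < d := hδ2.1
  have hη0 : 0 ≤ η := by positivity
  have hηr : η ≤ r / 4 := mul_le_of_le_one_right (by positivity) (min_le_left _ _)
  have hηφ : 2 * η ≤ r * φ := by
    have h1 : min 1 (min d (2 * min (1 / 4 : ℝ) (r / K) * φ)) ≤ 2 * (1 / 4) * φ :=
      ((min_le_right _ _).trans (min_le_right _ _)).trans (by gcongr; exact min_le_left _ _)
    have h2 : η ≤ r / 4 * (2 * (1 / 4) * φ) := by rw [hη]; gcongr
    nlinarith [mul_pos hr hΦpos]
  set w : X := T^[N] x - p with hw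
  have hw0 : 0 < ‖w‖ := hr.trans_le hN
  have hwK : ‖w‖ - r / 2 + η ≤ K := by
    have h0 := hi 0 (Nat.zero_le _)
    rw [Function.iterate_zero_apply] at h0
    linarith
  have hb1 : ‖‖w‖⁻¹ • w‖ = 1 := by
    rw [norm_smul, norm_inv, norm_norm, inv_mul_cancel₀ hw0.ne']
  have key : ∀ i ∈ Set.Icc n (n + g n),
      ‖(T^[i] x - p) - (‖w‖ + η) • ‖w‖⁻¹ • w‖ ≤ K * d := by
    intro i hmem
    refine (norm_sub_smul_le_of_almost_aligned
      (fun x₁ x₂ h₁ h₂ h => hΦ x₁ x₂ h₁ h₂ d hδ2 h) hr hη0 hηφ hN (hi i hmem.2) ?_).trans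
      (by gcongr)
    have hq : p + (r / 2) • ‖w‖⁻¹ • w ∈ Metric.closedBall p r := by
      rw [mem_closedBall_iff_norm, add_sub_cancel_left, norm_smul, hb1,
        Real.norm_of_nonneg (by positivity)]
      linarith
    have hwq : ‖w - (r / 2) • ‖w‖⁻¹ • w‖ = ‖w‖ - r / 2 := by
      have h : w - (r / 2) • ‖w‖⁻¹ • w = (‖w‖ - r / 2) • ‖w‖⁻¹ • w := by
        rw [sub_smul, smul_inv_smul₀ hw0.ne']
      rw [h, norm_smul, hb1, Real.norm_of_nonneg (by linarith), mul_one]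
    have h := hii _ hq i hmem
    rwa [← sub_sub, ← sub_sub, ← hw, hwq] at h
  intro i hmi j hmj
  have hKd : K * d + K * d = ε / 2 := by rw [hd]; field_simp; norm_num
  calc ‖T^[i] x - T^[j] x‖
      = ‖((T^[i] x - p) - (‖w‖ + η) • ‖w‖⁻¹ • w)
          - ((T^[j] x - p) - (‖w‖ + η) • ‖w‖⁻¹ • w)‖ := by
        rw [sub_sub_sub_cancel_right, sub_sub_sub_cancel_right]
    _ ≤ K * d + K * d := (norm_sub_le _ _).trans (add_le_add (key i hmi) (key j hmj))
    _ ≤ ε := by linarith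
end

section
/- Let T : C → C be a nonexpansive mapping on a subset C of a Banach space X with modulus of uniform convexity Φ, suppose B_r[p] ⊆ Fix(T) with r/K ≤ 2, and let x ∈ C with ‖x − p‖ < K. Then the function f(ε) := ⌈K/η⌉, where η := (r/4)·min(1, Ψ(min(1/4, r/K), ε/(2K))) and Ψ(h, ε') := min(ε'/2, 2h·Φ(ε'/2)), is a rate of asymptotic regularity for the Picard iterates: for every ε > 0 with ε/(2K) ∈ (0,4] and every i ≥ f(ε), ‖T^{i+1} x − T^i x‖ ≤ ε. -/
/-- `Ψ(h, ε') := min (ε'/2) (2h·Φ(ε'/2))`. -/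
noncomputable def Psi (Φ : ℝ → ℝ) (h ε' : ℝ) : ℝ := min (ε' / 2) (2 * h * Φ (ε' / 2))

/-- `η := (r/4)·min 1 (Ψ (min (1/4) (r/K)) (ε/(2K)))`. -/
noncomputable def eta (Φ : ℝ → ℝ) (K r ε : ℝ) : ℝ :=
  r / 4 * min 1 (Psi Φ (min (1 / 4) (r / K)) (ε / (2 * K)))

/-- If `v` is at least as close as `u` to every point of the ball of radius `r < ‖u - p‖` around
`p`, a deficit in the norm of the midpoint of `u - p` and `v - p` forces `v` to be closer
to `p` than `u` by a definite amount. -/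
theorem norm_sub_le_of_midpoint_deficit {X : Type*} [NormedAddCommGroup X] [NormedSpace ℝ X]
    {p u v : X} {r φ : ℝ} (hr : 0 < r) (hu : r < ‖u - p‖)
    (hball : ∀ y ∈ Metric.closedBall p r, ‖v - y‖ ≤ ‖u - y‖)
    (hmid : 1 / 2 * ‖(u - p) + (v - p)‖ ≤ (1 - φ) * ‖u - p‖) :
    ‖v - p‖ ≤ ‖u - p‖ - r * φ := by
  have hvp : ‖v - p‖ ≤ ‖u - p‖ := hball p (Metric.mem_closedBall_self hr.le)
  have hR : 0 < ‖u - p‖ := hr.trans hu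
  obtain ⟨s, hs⟩ : ∃ s, s = r / (2 * ‖u - p‖) := ⟨_, rfl⟩
  have hsR : 2 * s * ‖u - p‖ = r := by rw [hs]; field_simp
  have hs0 : 0 < s := by rw [hs]; positivity
  have hs1 : s < 1 / 2 := by nlinarith
  have hd : ‖u - v‖ ≤ 2 * ‖u - p‖ := by
    have := norm_sub_le (u - p) (v - p)
    rw [sub_sub_sub_cancel_right] at this
    linarith
  have hmem : p + s • (u - v) ∈ Metric.closedBall p r := by
    rw [mem_closedBall_iff_norm, add_sub_cancel_left, norm_smul, Real.norm_of_nonneg hs0.le]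
    nlinarith
  have hle := hball _ hmem
  have hconv : ‖v - p‖ ≤
      (1 - s) * ‖v - (p + s • (u - v))‖ + s * ‖u - (p + s • (u - v))‖ := by
    have : v - p = (1 - s) • (v - (p + s • (u - v))) + s • (u - (p + s • (u - v))) := by
      module
    conv_lhs => rw [this]
    refine (norm_add_le _ _).trans_eq ?_
    rw [norm_smul, norm_smul, Real.norm_of_nonneg hs0.le, Real.norm_of_nonneg (by linarith)]
  have hend : ‖u - (p + s • (u - v))‖ ≤
      s * ‖(u - p) + (v - p)‖ + (1 - 2 * s) * ‖u - p‖ := by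
    have : u - (p + s • (u - v)) = s • ((u - p) + (v - p)) + (1 - 2 * s) • (u - p) := by
      module
    rw [this]
    refine (norm_add_le _ _).trans_eq ?_
    rw [norm_smul, norm_smul, Real.norm_of_nonneg hs0.le, Real.norm_of_nonneg (by linarith)]
  have h₁ : ‖v - p‖ ≤ ‖u - (p + s • (u - v))‖ := by nlinarith
  have h₂ : s * ‖(u - p) + (v - p)‖ ≤ 2 * s * ((1 - φ) * ‖u - p‖) := by nlinarith
  have h₃ : 2 * s * ((1 - φ) * ‖u - p‖) + (1 - 2 * s) * ‖u - p‖ =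
      ‖u - p‖ - 2 * s * ‖u - p‖ * φ := by ring
  rw [hsR] at h₃
  linarith

/-- Homogeneous form of uniform convexity at a fixed separation `e`. -/
theorem midpoint_deficit_of_modulus {X : Type*} [NormedAddCommGroup X] [NormedSpace ℝ X]
    {e φ : ℝ} (hφ : ∀ x₁ x₂ : X, ‖x₁‖ ≤ 1 → ‖x₂‖ ≤ 1 →
      (1 : ℝ) / 2 * ‖x₁ + x₂‖ ≥ 1 - φ → ‖x₁ - x₂‖ ≤ e)
    {a b : X} (ha : a ≠ 0) (hba : ‖b‖ ≤ ‖a‖) (hab : e * ‖a‖ < ‖a - b‖) :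
    1 / 2 * ‖a + b‖ ≤ (1 - φ) * ‖a‖ := by
  have hR : 0 < ‖a‖ := norm_pos_iff.mpr ha
  have hscale (z : X) : ‖‖a‖⁻¹ • z‖ = ‖z‖ / ‖a‖ := by
    rw [norm_smul, norm_inv, norm_norm, inv_mul_eq_div]
  by_contra! hlt
  have h := hφ (‖a‖⁻¹ • a) (‖a‖⁻¹ • b) (by rw [hscale, div_self hR.ne'])
    (by rw [hscale]; exact (div_le_one hR).mpr hba)
    (by rw [← smul_add, hscale, ge_iff_le, ← mul_div_assoc, le_div_iff₀ hR]; exact hlt.le)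
  rw [← smul_sub, hscale, div_le_iff₀ hR] at h
  linarith

/-- A nonnegative sequence starting below `K` cannot drop by `η` at each of the first
`⌈K / η⌉₊` steps. -/
theorem exists_lt_ceil_sub_lt {a : ℕ → ℝ} {K η : ℝ} (hη : 0 < η) (ha : ∀ n, 0 ≤ a n)
    (hK : a 0 < K) : ∃ j < ⌈K / η⌉₊, a j - η < a (j + 1) := by
  by_contra! h
  have key : ∀ n ≤ ⌈K / η⌉₊, a n ≤ a 0 - n * η := by
    intro n
    induction n with
    | zero => simp
    | succ n ih =>
      intro hn
      have h₁ := ih (by lia)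
      have h₂ := h n (by lia)
      push_cast
      linarith
  have h₁ := key _ le_rfl
  have h₂ := (div_le_iff₀ hη).mp (Nat.le_ceil (K / η))
  linarith [ha ⌈K / η⌉₊]

/-- Rate of asymptotic regularity for the Picard iterates of a nonexpansive map `T` with
`B_r[p] ⊆ Fix T`: for every `ε > 0` with `ε/(2K) ∈ (0,4]` and every `i ≥ ⌈K/η⌉`,
`‖T^(i+1) x - T^i x‖ ≤ ε`. -/
theorem stmt17 {X : Type*} [NormedAddCommGroup X] [NormedSpace ℝ X] [CompleteSpace X]
    (Φ : ℝ → ℝ) (hΦrange : ∀ ε ∈ Set.Ioc (0 : ℝ) 2, Φ ε ∈ Set.Ioc (0 : ℝ) 1)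
    (hΦ : ∀ x₁ x₂ : X, ‖x₁‖ ≤ 1 → ‖x₂‖ ≤ 1 → ∀ ε ∈ Set.Ioc (0 : ℝ) 2,
      (1 : ℝ) / 2 * ‖x₁ + x₂‖ ≥ 1 - Φ ε → ‖x₁ - x₂‖ ≤ ε)
    (C : Set X) (T : X → X) (hT : Set.MapsTo T C C)
    (hnonexp : ∀ x ∈ C, ∀ y ∈ C, ‖T x - T y‖ ≤ ‖x - y‖)
    (p : X) (r : ℝ) (hr : 0 < r)
    (hball : Metric.closedBall p r ⊆ {y | y ∈ C ∧ T y = y})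
    (x : X) (hx : x ∈ C) (K : ℝ) (hK : 0 < K) (hxp : ‖x - p‖ < K) (hrK : r / K ≤ 2) :
    ∀ ε > (0 : ℝ), ε / (2 * K) ∈ Set.Ioc (0 : ℝ) 4 →
      ∀ i ≥ ⌈K / eta Φ K r ε⌉₊, ‖T^[i + 1] x - T^[i] x‖ ≤ ε := by
  intro ε hε he i hi
  have he' : ε / (2 * K) / 2 ∈ Set.Ioc (0 : ℝ) 2 :=
    ⟨by linarith [he.1], by linarith [he.2]⟩
  obtain ⟨e, hedef⟩ : ∃ e, e = ε / (2 * K) / 2 := ⟨_, rfl⟩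
  have heK : e * K = ε / 4 := by rw [hedef]; field_simp; ring
  rw [← hedef] at he'
  obtain ⟨hφ, -⟩ := hΦrange e he'
  have hη : 0 < eta Φ K r ε := by
    unfold eta Psi
    rw [← hedef]
    have := he'.1
    positivity
  have hηle : eta Φ K r ε ≤ r * Φ e := by
    have h : min 1 (Psi Φ (min (1 / 4) (r / K)) (ε / (2 * K))) ≤ Φ e := by
      unfold Psi
      rw [← hedef]
      refine (min_le_right _ _).trans ((min_le_right _ _).trans ?_)
      nlinarith [min_le_left (1 / 4 : ℝ) (r / K)]
    unfold eta
    nlinarith [mul_pos hr hφ]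
  have hmem (n : ℕ) : T^[n] x ∈ C := hT.iterate n hx
  have hanti : Antitone fun n => ‖T^[n + 1] x - T^[n] x‖ := antitone_nat_of_succ_le fun n => by
    rw [Function.iterate_succ_apply' T (n + 1), Function.iterate_succ_apply' T n]
    exact hnonexp _ (hT (hmem n)) _ (hmem n)
  have hstep (n : ℕ) : ∀ y ∈ Metric.closedBall p r, ‖T^[n + 1] x - y‖ ≤ ‖T^[n] x - y‖ := by
    intro y hy
    obtain ⟨hyC, hyT⟩ := hball hy
    have h := hnonexp _ (hmem n) y hyC
    rwa [hyT, ← Function.iterate_succ_apply' T n] at h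
  have hpmem := Metric.mem_closedBall_self (x := p) hr.le
  have hdist : Antitone fun n => ‖T^[n] x - p‖ :=
    antitone_nat_of_succ_le fun n => hstep n p hpmem
  obtain ⟨j, hj, hdrop⟩ :=
    exists_lt_ceil_sub_lt (a := fun n => ‖T^[n] x - p‖) hη (fun _ => norm_nonneg _) hxp
  refine (hanti (hj.le.trans hi)).trans ?_
  by_contra! hgt
  have hfar : r < ‖T^[j] x - p‖ := by
    by_contra! hnear
    have h := (hball (mem_closedBall_iff_norm.mpr hnear)).2
    rw [Function.iterate_succ_apply', h, sub_self, norm_zero] at hgt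
    linarith
  have hRK : ‖T^[j] x - p‖ < K := (hdist (Nat.zero_le j)).trans_lt hxp
  have hmid := midpoint_deficit_of_modulus
    (fun x₁ x₂ h₁ h₂ => hΦ x₁ x₂ h₁ h₂ e he') (norm_pos_iff.mp (hr.trans hfar))
    (hstep j p hpmem) (by
      rw [sub_sub_sub_cancel_right, norm_sub_rev (T^[j] x) (T^[j + 1] x)]
      have := mul_lt_mul_of_pos_left hRK he'.1
      linarith)
  have := norm_sub_le_of_midpoint_deficit hr hfar (hstep j) hmid
  linarith
end

section
/- Let 2 ≤ p < ∞, let X = L^p be the real Lebesgue space L^p(μ) over a measure space, and let T : C → C be a nonexpansive mapping on a subset C ⊆ X. Suppose B_r[q] ⊆ Fix(T) for some q ∈ X and r > 0, and let x ∈ C with ‖x − q‖ < K. Then for every ε > 0 and every i ≥ f(ε), ‖T^{i+1} x − T^i x‖ ≤ ε, where f(ε) := ⌈(p · 2^{3p+1} · K^{p+2}) / (ε^p · r²)⌉. -/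
open MeasureTheory

lemma clarkson_real {p : ℝ} (hp : 2 ≤ p) (x y : ℝ) :
    2 * (|x| ^ p + |y| ^ p) ≤ |x + y| ^ p + |x - y| ^ p := by
  have hsq : ∀ z : ℝ, |z| ^ p = (z ^ 2) ^ (p / 2) := fun z => by
    rw [← sq_abs, ← Real.rpow_natCast, ← Real.rpow_mul (abs_nonneg z)]
    congr 1
    push_cast
    ring
  have hp' : 1 ≤ p / 2 := by linarith
  have hsuper := Real.add_rpow_le_rpow_add (sq_nonneg x) (sq_nonneg y) hp'
  have hconv := (convexOn_rpow hp').2 (x := (x + y) ^ 2) (y := (x - y) ^ 2)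
    (Set.mem_Ici.2 (sq_nonneg _)) (Set.mem_Ici.2 (sq_nonneg _))
    (by norm_num : (0 : ℝ) ≤ 1 / 2) (by norm_num : (0 : ℝ) ≤ 1 / 2) (by norm_num)
  simp only [smul_eq_mul] at hconv
  rw [show 1 / 2 * (x + y) ^ 2 + 1 / 2 * (x - y) ^ 2 = x ^ 2 + y ^ 2 by ring] at hconv
  simp only [hsq]
  linarith

lemma Lp_norm_rpow_eq_integral {α : Type*} [MeasurableSpace α] {μ : Measure α} {p : ℝ}
    (hp : 0 < p) (f : Lp ℝ (ENNReal.ofReal p) μ) : ‖f‖ ^ p = ∫ t, |f t| ^ p ∂μ := by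
  have hint : 0 ≤ ∫ t, |f t| ^ p ∂μ :=
    integral_nonneg fun t => Real.rpow_nonneg (abs_nonneg _) _
  rw [Lp.norm_def, toReal_eLpNorm (Lp.aestronglyMeasurable f),
    lpNorm_eq_integral_norm_rpow_toReal (by simpa using hp) ENNReal.ofReal_ne_top
      (Lp.aestronglyMeasurable f)]
  simp only [ENNReal.toReal_ofReal hp.le, Real.norm_eq_abs]
  rw [← Real.rpow_mul hint, inv_mul_cancel₀ hp.ne', Real.rpow_one]

lemma Lp_integrable_abs_rpow {α : Type*} [MeasurableSpace α] {μ : Measure α} {p : ℝ}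
    (hp : 0 < p) (f : Lp ℝ (ENNReal.ofReal p) μ) : Integrable (fun t => |f t| ^ p) μ := by
  simpa [ENNReal.toReal_ofReal hp.le] using
    (Lp.memLp f).integrable_norm_rpow (by simpa using hp) ENNReal.ofReal_ne_top

lemma clarkson_Lp {α : Type*} [MeasurableSpace α] {μ : Measure α} {p : ℝ} (hp : 2 ≤ p)
    (f g : Lp ℝ (ENNReal.ofReal p) μ) :
    2 * (‖f‖ ^ p + ‖g‖ ^ p) ≤ ‖f + g‖ ^ p + ‖f - g‖ ^ p := by
  have hp0 : 0 < p := by linarith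
  have hint := fun h : Lp ℝ (ENNReal.ofReal p) μ => Lp_integrable_abs_rpow hp0 h
  simp only [Lp_norm_rpow_eq_integral hp0]
  rw [← integral_add (hint f) (hint g), ← integral_add (hint (f + g)) (hint (f - g)),
    ← integral_const_mul]
  refine integral_mono_ae (((hint f).add (hint g)).const_mul 2)
    ((hint (f + g)).add (hint (f - g))) ?_
  filter_upwards [Lp.coeFn_add f g, Lp.coeFn_sub f g] with t hadd hsub
  simpa only [hadd, hsub, Pi.add_apply, Pi.sub_apply] using clarkson_real hp (f t) (g t)

lemma convexOn_norm_sub_smul_rpow {E : Type*} [NormedAddCommGroup E] [NormedSpace ℝ E]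
    {p : ℝ} (hp : 1 ≤ p) (a w : E) :
    ConvexOn ℝ Set.univ (fun s : ℝ => ‖a - s • w‖ ^ p) := by
  refine ⟨convex_univ, fun s _ t _ c d hc hd hcd => ?_⟩
  have hsplit : a - (c • s + d • t) • w = c • (a - s • w) + d • (a - t • w) := by
    obtain rfl : d = 1 - c := by linarith
    simp only [smul_eq_mul]
    module
  have hnorm : ‖a - (c • s + d • t) • w‖ ≤ c * ‖a - s • w‖ + d * ‖a - t • w‖ := by
    rw [hsplit]
    refine (norm_add_le _ _).trans_eq ?_
    rw [norm_smul, norm_smul, Real.norm_of_nonneg hc, Real.norm_of_nonneg hd]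
  refine (Real.rpow_le_rpow (norm_nonneg _) hnorm (by linarith)).trans ?_
  simpa only [smul_eq_mul] using (convexOn_rpow hp).2 (Set.mem_Ici.2 (norm_nonneg _))
    (Set.mem_Ici.2 (norm_nonneg _)) hc hd hcd

/-- In a normed space satisfying Clarkson's inequality with exponent `p`, the mixed second
difference of `s ↦ ‖a - s • w‖ ^ p` with steps `1` and `τ` is at least `2 τ (‖w‖ / 4) ^ p`. -/
lemma mul_norm_rpow_le_mixed_difference {E : Type*} [NormedAddCommGroup E] [NormedSpace ℝ E]
    {p : ℝ} (hp : 1 ≤ p)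
    (hclarkson : ∀ x y : E, 2 * (‖x‖ ^ p + ‖y‖ ^ p) ≤ ‖x + y‖ ^ p + ‖x - y‖ ^ p)
    (a w : E) {τ : ℝ} (hτ : 0 < τ) (hτ' : τ ≤ 1 / 2) :
    2 * τ * (‖w‖ / 4) ^ p ≤
      ‖a‖ ^ p - ‖a - τ • w‖ ^ p - ‖a - w‖ ^ p + ‖a - (1 + τ) • w‖ ^ p := by
  set H : ℝ → ℝ := fun s => ‖a - s • w‖ ^ p with hH
  have hconv : ConvexOn ℝ Set.univ H := convexOn_norm_sub_smul_rpow hp a w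
  set d : ℝ := (1 - τ) / 2 with hd
  have hd4 : 1 / 4 ≤ d := by rw [hd]; linarith
  have hd0 : 0 < d := by linarith
  have hleft := hconv.slope_mono_adjacent (x := 0) (y := τ) (z := τ + d) trivial trivial hτ
    (by linarith)
  have hright := hconv.slope_mono_adjacent (x := τ + d) (y := 1) (z := 1 + τ) trivial trivial
    (by rw [hd]; linarith) (by linarith)
  rw [show τ - 0 = τ by ring, show τ + d - τ = d by ring, div_le_div_iff₀ hτ hd0] at hleft
  rw [show 1 - (τ + d) = d by rw [hd]; ring, show 1 + τ - 1 = τ by ring,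
    div_le_div_iff₀ hd0 hτ] at hright
  have hmid := hclarkson (a - (τ + d) • w) (d • w)
  rw [show a - (τ + d) • w + d • w = a - τ • w by module,
    show a - (τ + d) • w - d • w = a - (1 : ℝ) • w by
      rw [show (1 : ℝ) = τ + d + d by rw [hd]; ring]; module] at hmid
  have hscale : (‖w‖ / 4) ^ p ≤ ‖d • w‖ ^ p := by
    refine Real.rpow_le_rpow (by positivity) ?_ (by linarith)
    rw [norm_smul, Real.norm_of_nonneg hd0.le]
    nlinarith [norm_nonneg w]
  have hcurv : 2 * (‖w‖ / 4) ^ p ≤ H τ + H 1 - 2 * H (τ + d) := by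
    simp only [hH]
    linarith
  have hpos : 0 ≤ 2 * (‖w‖ / 4) ^ p := by positivity
  have hd1 : d ≤ 1 := by rw [hd]; linarith
  have hdiff : 2 * τ * (‖w‖ / 4) ^ p ≤ H 0 - H τ - H 1 + H (1 + τ) := by
    have hscaled := mul_le_mul_of_nonneg_left hcurv hτ.le
    have hmul : (2 * τ * (‖w‖ / 4) ^ p) * d ≤ (H 0 - H τ - H 1 + H (1 + τ)) * d := by
      have : (2 * τ * (‖w‖ / 4) ^ p) * d ≤ 2 * τ * (‖w‖ / 4) ^ p :=
        mul_le_of_le_one_right (by positivity) hd1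
      linarith
    exact le_of_mul_le_mul_right hmul hd0
  simpa [hH] using hdiff

lemma antitone_norm_iterate_succ_sub {E : Type*} [NormedAddCommGroup E] {C : Set E} {T : E → E}
    (hT : Set.MapsTo T C C) (hnonexp : ∀ x ∈ C, ∀ y ∈ C, ‖T x - T y‖ ≤ ‖x - y‖)
    {x : E} (hx : x ∈ C) : Antitone fun n => ‖T^[n + 1] x - T^[n] x‖ := by
  refine antitone_nat_of_succ_le fun n => ?_
  simpa only [Function.iterate_succ_apply'] using
    hnonexp _ (hT.iterate (n + 1) hx) _ (hT.iterate n hx)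

/-- Summing the decrease of `‖T^[i] x - q‖ ^ p` bounds the displacement at step `n`. -/
lemma norm_iterate_succ_sub_rpow_mul_le {E : Type*} [NormedAddCommGroup E] [NormedSpace ℝ E]
    {p : ℝ} (hp : 1 ≤ p)
    (hclarkson : ∀ x y : E, 2 * (‖x‖ ^ p + ‖y‖ ^ p) ≤ ‖x + y‖ ^ p + ‖x - y‖ ^ p)
    {C : Set E} {T : E → E} (hT : Set.MapsTo T C C)
    (hnonexp : ∀ x ∈ C, ∀ y ∈ C, ‖T x - T y‖ ≤ ‖x - y‖)
    {q : E} {r : ℝ} (hr : 0 < r)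
    (hball : Metric.closedBall q r ⊆ {y | y ∈ C ∧ T y = y})
    {x : E} (hx : x ∈ C) {K : ℝ} (hrK : r ≤ K) (hxq : ‖x - q‖ ≤ K) (n : ℕ) :
    (n + 1) * (2 * (r / (4 * K)) * (‖T^[n + 1] x - T^[n] x‖ / 4) ^ p) ≤ K ^ p := by
  have hK : 0 < K := hr.trans_le hrK
  have hτ : 0 < r / (4 * K) := by positivity
  have hτ' : r / (4 * K) ≤ 1 / 2 := by
    rw [div_le_iff₀ (by positivity)]
    linarith
  set τ := r / (4 * K) with hτ_def
  have hiter : ∀ i, T^[i] x ∈ C := fun i => hT.iterate i hx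
  have hfix : ∀ i, ∀ y ∈ Metric.closedBall q r, ‖T^[i + 1] x - y‖ ≤ ‖T^[i] x - y‖ := by
    intro i y hy
    have h := hnonexp _ (hiter i) y (hball hy).1
    rwa [(hball hy).2, ← Function.iterate_succ_apply' T] at h
  have hq : q ∈ Metric.closedBall q r := Metric.mem_closedBall_self hr.le
  have hbdd : ∀ i, ‖T^[i] x - q‖ ≤ K := by
    intro i
    induction i with
    | zero => simpa using hxq
    | succ i ih => exact (hfix i q hq).trans ih
  have hstep : ∀ i, 2 * τ * (‖T^[i + 1] x - T^[i] x‖ / 4) ^ p ≤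
      ‖T^[i] x - q‖ ^ p - ‖T^[i + 1] x - q‖ ^ p := by
    intro i
    have hw : ‖T^[i] x - T^[i + 1] x‖ ≤ 2 * K := by
      have h := norm_sub_le (T^[i] x - q) (T^[i + 1] x - q)
      rw [sub_sub_sub_cancel_right] at h
      linarith [hbdd i, hbdd (i + 1)]
    have hmem : q + τ • (T^[i] x - T^[i + 1] x) ∈ Metric.closedBall q r := by
      rw [mem_closedBall_iff_norm, add_sub_cancel_left, norm_smul, Real.norm_of_nonneg hτ.le]
      calc τ * ‖T^[i] x - T^[i + 1] x‖ ≤ τ * (2 * K) := by gcongr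
        _ = r / 2 := by rw [hτ_def]; field_simp; ring
        _ ≤ r := by linarith
    have hdecr := Real.rpow_le_rpow (norm_nonneg _) (hfix i _ hmem) (by linarith : 0 ≤ p)
    have hmixed := mul_norm_rpow_le_mixed_difference hp hclarkson (T^[i] x - q)
      (T^[i] x - T^[i + 1] x) hτ hτ'
    rw [sub_sub_sub_cancel_left, norm_sub_rev (T^[i] x) (T^[i + 1] x),
      sub_sub (T^[i] x) q,
      show T^[i] x - q - (1 + τ) • (T^[i] x - T^[i + 1] x) =
        T^[i + 1] x - (q + τ • (T^[i] x - T^[i + 1] x)) by module] at hmixed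
    linarith
  have hanti := antitone_norm_iterate_succ_sub hT hnonexp hx
  calc (n + 1) * (2 * τ * (‖T^[n + 1] x - T^[n] x‖ / 4) ^ p)
      = ∑ _i ∈ Finset.range (n + 1), 2 * τ * (‖T^[n + 1] x - T^[n] x‖ / 4) ^ p := by simp
    _ ≤ ∑ i ∈ Finset.range (n + 1), (‖T^[i] x - q‖ ^ p - ‖T^[i + 1] x - q‖ ^ p) := by
        refine Finset.sum_le_sum fun i hi => le_trans ?_ (hstep i)
        have := hanti (Nat.lt_succ_iff.1 (Finset.mem_range.1 hi))
        gcongr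
    _ = ‖x - q‖ ^ p - ‖T^[n + 1] x - q‖ ^ p := by rw [Finset.sum_range_sub']; simp
    _ ≤ ‖x - q‖ ^ p := sub_le_self _ (by positivity)
    _ ≤ K ^ p := Real.rpow_le_rpow (norm_nonneg _) hxq (by linarith)

/-- Rate of asymptotic regularity for a nonexpansive map on a subset of `L^p` (`2 ≤ p < ∞`)
whose fixed point set contains `B_r[q]`: for all `ε > 0` and
`i ≥ ⌈p·2^(3p+1)·K^(p+2) / (ε^p·r²)⌉`, `‖T^(i+1) x - T^i x‖ ≤ ε`. -/
theorem stmt18 {α : Type*} [MeasurableSpace α] (μ : Measure α)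
    (p : ℝ) (hp : 2 ≤ p) [hfact : Fact (1 ≤ ENNReal.ofReal p)]
    (C : Set (Lp ℝ (ENNReal.ofReal p) μ))
    (T : Lp ℝ (ENNReal.ofReal p) μ → Lp ℝ (ENNReal.ofReal p) μ)
    (hT : Set.MapsTo T C C)
    (hnonexp : ∀ x ∈ C, ∀ y ∈ C, ‖T x - T y‖ ≤ ‖x - y‖)
    (q : Lp ℝ (ENNReal.ofReal p) μ) (r : ℝ) (hr : 0 < r)
    (hball : Metric.closedBall q r ⊆ {y | y ∈ C ∧ T y = y})
    (x : Lp ℝ (ENNReal.ofReal p) μ) (hx : x ∈ C)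
    (K : ℝ) (hK : 0 < K) (hxq : ‖x - q‖ < K) :
    ∀ ε > (0 : ℝ),
      ∀ i ≥ ⌈p * (2 : ℝ) ^ (3 * p + 1) * K ^ (p + 2) / (ε ^ p * r ^ 2)⌉₊,
        ‖T^[i + 1] x - T^[i] x‖ ≤ ε := by
  intro ε hε i hi
  rcases lt_or_ge K r with hKr | hrK
  · have hfix : T x = x :=
      (hball (mem_closedBall_iff_norm.2 (hxq.trans hKr).le)).2
    rw [Function.iterate_fixed hfix, Function.iterate_fixed hfix, sub_self, norm_zero]
    exact hε.le
  by_contra! hlt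
  have hp0 : 0 < p := by linarith
  have hbound := norm_iterate_succ_sub_rpow_mul_le (by linarith) (clarkson_Lp hp) hT hnonexp hr
    hball hx hrK hxq.le i
  have hi' := (Nat.le_ceil _).trans (Nat.cast_le (α := ℝ).2 hi)
  have hεp : (ε / 4) ^ p ≤ (‖T^[i + 1] x - T^[i] x‖ / 4) ^ p :=
    Real.rpow_le_rpow (by positivity) (by linarith) hp0.le
  have hbound' : (i + 1) * (2 * (r / (4 * K)) * (ε / 4) ^ p) ≤ K ^ p :=
    le_trans (by gcongr) hbound
  have hi_pos : (0 : ℝ) < i + 1 := by positivity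
  rw [Real.div_rpow hε.le (by norm_num)] at hbound'
  have h2 : (4 : ℝ) ^ p ≤ (2 : ℝ) ^ (3 * p + 1) := by
    rw [show (4 : ℝ) = 2 ^ (2 : ℝ) by norm_num, ← Real.rpow_mul (by norm_num)]
    exact Real.rpow_le_rpow_of_exponent_le (by norm_num) (by linarith)
  have hKp : K ^ (p + 2) = K ^ p * K ^ 2 := by
    rw [Real.rpow_add hK, Real.rpow_two]
  rw [hKp, div_le_iff₀ (by positivity)] at hi'
  have hupper : (i + 1) * (r * ε ^ p) ≤ 2 * K * 4 ^ p * K ^ p := by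
    have h4 : (0 : ℝ) < 4 ^ p := by positivity
    calc (i + 1) * (r * ε ^ p)
        = (i + 1) * (2 * (r / (4 * K)) * (ε ^ p / 4 ^ p)) * (2 * K * 4 ^ p) := by
          field_simp
          ring
      _ ≤ K ^ p * (2 * K * 4 ^ p) := by gcongr
      _ = 2 * K * 4 ^ p * K ^ p := by ring
  have hcontra : (i + 1) * (ε ^ p * r ^ 2) ≤ i * (ε ^ p * r ^ 2) := by
    calc (i + 1) * (ε ^ p * r ^ 2) = (i + 1) * (r * ε ^ p) * r := by ring
      _ ≤ 2 * K * 4 ^ p * K ^ p * K := by gcongr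
      _ = 2 * 4 ^ p * (K ^ p * K ^ 2) := by ring
      _ ≤ p * 2 ^ (3 * p + 1) * (K ^ p * K ^ 2) := by gcongr
      _ ≤ i * (ε ^ p * r ^ 2) := hi'
  have : 0 < ε ^ p * r ^ 2 := by positivity
  linarith
end

section
/- Suppose T : C → C is asymptotically nonexpansive with respect to a sequence (μ_n) with μ_n → 1, B_r[p] ⊆ Fix(T), and x ∈ C with ‖x − p‖ < K. Suppose further that μ_n ≤ L for all n (L > 0), and that φ is a rate of metastability for (μ_n), i.e. for all δ > 0 and h : ℕ → ℕ there exists k ≤ φ(δ, h) such that μ_m ≤ 1 + δ for all m ∈ [k, k + h(k)]. Then the function Γ_{L,φ}(K, r, ε, g, N) := N + φ(ε/(L(K + r)), g_N), where g_N(k) := g(N + k), is a metastable rate of asymptotic decreasingness for (‖T^n x − q‖)_{n∈ℕ} uniform in q ∈ B_r[p]: for all ε > 0, g : ℕ → ℕ, N ∈ ℕ and q ∈ B_r[p], there exists n ≤ Γ_{L,φ}(K, r, ε, g, N) such that ‖T^i x − q‖ ≤ ‖T^N x − q‖ + ε for all i ∈ [n, n + g(n)]. -/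
/-- Let `T : C → C` be asymptotically nonexpansive w.r.t. `μ_n → 1`, with `B_r[p] ⊆ Fix T`,
`‖x - p‖ < K`, `μ_n ≤ L` for all `n`, and `φ` a rate of metastability for `(μ_n)`.  Then
`Γ_{L,φ}(K, r, ε, g, N) := N + φ(ε/(L(K+r)), g_N)` with `g_N k := g (N + k)` is a metastable
rate of asymptotic decreasingness for `(‖T^n x - q‖)`, uniformly in `q ∈ B_r[p]`. -/
theorem stmt19 {X : Type*} [NormedAddCommGroup X] [NormedSpace ℝ X]
    (C : Set X) (T : X → X) (hT : Set.MapsTo T C C)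
    (μ : ℕ → ℝ) (hμ : Filter.Tendsto μ Filter.atTop (nhds 1))
    (hane : ∀ x ∈ C, ∀ y ∈ C, ∀ n : ℕ, ‖T^[n] x - T^[n] y‖ ≤ μ n * ‖x - y‖)
    (p : X) (r : ℝ) (hr : 0 < r)
    (hball : Metric.closedBall p r ⊆ {y | y ∈ C ∧ T y = y})
    (x : X) (hx : x ∈ C) (K : ℝ) (hK : 0 < K) (hxp : ‖x - p‖ < K)
    (L : ℝ) (hL : 0 < L) (hμL : ∀ n, μ n ≤ L)
    (φ : ℝ → (ℕ → ℕ) → ℕ)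
    (hφ : ∀ δ > (0 : ℝ), ∀ h : ℕ → ℕ, ∃ k ≤ φ δ h,
      ∀ m ∈ Set.Icc k (k + h k), μ m ≤ 1 + δ) :
    ∀ ε > (0 : ℝ), ∀ g : ℕ → ℕ, ∀ N : ℕ, ∀ q ∈ Metric.closedBall p r,
      ∃ n ≤ N + φ (ε / (L * (K + r))) (fun k => g (N + k)),
        ∀ i ∈ Set.Icc n (n + g n), ‖T^[i] x - q‖ ≤ ‖T^[N] x - q‖ + ε := by
  intro ε hε g N q hq
  have hfix : ∀ n : ℕ, T^[n] q = q := fun n => Function.iterate_fixed (hball hq).2 n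
  have hqC : q ∈ C := (hball hq).1
  have hKr : 0 < L * (K + r) := by positivity
  have hxq : ‖x - q‖ ≤ K + r := by
    have hpq : ‖p - q‖ ≤ r := by
      rwa [← dist_eq_norm, dist_comm]
    linarith [norm_sub_le_norm_sub_add_norm_sub x p q]
  have hbound : ‖T^[N] x - q‖ ≤ L * (K + r) := by
    calc ‖T^[N] x - q‖ = ‖T^[N] x - T^[N] q‖ := by rw [hfix]
      _ ≤ μ N * ‖x - q‖ := hane x hx q hqC N
      _ ≤ L * ‖x - q‖ := mul_le_mul_of_nonneg_right (hμL N) (norm_nonneg _)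
      _ ≤ L * (K + r) := mul_le_mul_of_nonneg_left hxq hL.le
  obtain ⟨k, hk, hμk⟩ := hφ (ε / (L * (K + r))) (div_pos hε hKr) (fun k => g (N + k))
  refine ⟨N + k, Nat.add_le_add_left hk N, fun i hi => ?_⟩
  obtain ⟨m, rfl⟩ := Nat.exists_eq_add_of_le' (le_of_add_le_left hi.1)
  have hm : m ∈ Set.Icc k (k + g (N + k)) := by
    obtain ⟨hlower, hupper⟩ := hi
    constructor <;> omega
  calc ‖T^[m + N] x - q‖ = ‖T^[m] (T^[N] x) - T^[m] q‖ := by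
        rw [hfix, Function.iterate_add_apply]
    _ ≤ μ m * ‖T^[N] x - q‖ := hane _ (hT.iterate N hx) q hqC m
    _ ≤ (1 + ε / (L * (K + r))) * ‖T^[N] x - q‖ :=
        mul_le_mul_of_nonneg_right (hμk m hm) (norm_nonneg _)
    _ = ‖T^[N] x - q‖ + ε / (L * (K + r)) * ‖T^[N] x - q‖ := by ring
    _ ≤ ‖T^[N] x - q‖ + ε / (L * (K + r)) * (L * (K + r)) := by gcongr
    _ = ‖T^[N] x - q‖ + ε := by rw [div_mul_cancel₀ ε hKr.ne']
end
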